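/- arXiv:1507.04465 — 2 statements merged into one kernel-verified Lean document; each statement's English description precedes it below -/
import Mathlib

section
/- There exist absolute constants C1, C2 > 0 such that for every integer k ≥ 1, one has C1 · k^{1-δ} (1 + log k)^{-3/2} ≤ E|𝓛(X_k)| ≤ C2 · k^{1-δ} (1 + log k)^{-3/2}, where δ = 1 - (1 + log log 2)/log 2. -/
open scoped BigOperators

noncomputable section

/-- The set `𝓛(c) = { m₁ + 2m₂ + ⋯ + k·m_k : 0 ≤ m_j ≤ c_j }`. -/
def Lset (k : ℕ) (c : Fin k → ℕ) : Finset ℕ :=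
  (Finset.Icc 0 c).image fun m => ∑ j : Fin k, ((j : ℕ) + 1) * m j

/-- Probability mass of a Poisson random variable with parameter `lam` at `n`. -/
def poissonPdf (lam : ℝ) (n : ℕ) : ℝ := Real.exp (-lam) * lam ^ n / (Nat.factorial n)

/-- Joint probability mass of the independent vector `X_k = (X_1,…,X_k)`,
`X_i ∼ Pois(1/i)`, at `c`. -/
def pmfVec (k : ℕ) (c : Fin k → ℕ) : ℝ := ∏ i : Fin k, poissonPdf (1 / ((i : ℕ) + 1)) (c i)

/-- `E|𝓛(X_k)|`. -/
def EL (k : ℕ) : ℝ := ∑' c : Fin k → ℕ, ((Lset k c).card : ℝ) * pmfVec k c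

/-- `δ = 1 - (1 + log log 2)/log 2`. -/
def delta : ℝ := 1 - (1 + Real.log (Real.log 2)) / Real.log 2

/-- Weight of a single step from depth `a` to depth `b`, where the depth changes by `1 - y` with
weight `1 / y!`. -/
def stepWeight (a b : ℕ) : ℝ := if b ≤ a + 1 then ((a + 1 - b).factorial : ℝ)⁻¹ else 0

/-- Total weight of the `n`-step paths from depth `a` to depth `b` all of whose depths are
non-negative. -/
def pathWeight : ℕ → ℕ → ℕ → ℝ
  | 0, a, b => if a = b then 1 else 0
  | n + 1, a, b => ∑ c ∈ Finset.range (a + 2), stepWeight a c * pathWeight n c b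

lemma stepWeight_nonneg (a b : ℕ) : 0 ≤ stepWeight a b := by
  unfold stepWeight; split_ifs <;> positivity

lemma pathWeight_nonneg (n a b : ℕ) : 0 ≤ pathWeight n a b := by
  induction n generalizing a with
  | zero => unfold pathWeight; split_ifs <;> norm_num
  | succ n ih =>
    exact Finset.sum_nonneg fun c _ => mul_nonneg (stepWeight_nonneg a c) (ih c)

lemma stepWeight_eq_zero {a b : ℕ} (h : a + 1 < b) : stepWeight a b = 0 :=
  if_neg (by omega)

lemma pathWeight_eq_zero {n a b : ℕ} (h : a + n < b) : pathWeight n a b = 0 := by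
  induction n generalizing a with
  | zero => exact if_neg (by omega)
  | succ n ih =>
    refine Finset.sum_eq_zero fun c hc => ?_
    rw [Finset.mem_range] at hc
    rw [ih (by omega), mul_zero]

lemma pathWeight_succ_eq_sum (n a b K : ℕ) (hK : a + 2 ≤ K) :
    pathWeight (n + 1) a b = ∑ c ∈ Finset.range K, stepWeight a c * pathWeight n c b := by
  refine Finset.sum_subset (Finset.range_mono hK) fun c _ hc => ?_
  rw [Finset.mem_range, not_lt] at hc
  rw [stepWeight_eq_zero (by omega), zero_mul]

lemma pathWeight_one (a b : ℕ) : pathWeight 1 a b = stepWeight a b := by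
  rw [pathWeight_succ_eq_sum 0 a b (a + b + 2) (by omega)]
  simp only [pathWeight, mul_ite, mul_one, mul_zero]
  rw [Finset.sum_ite_eq', if_pos (Finset.mem_range.2 (by omega))]

lemma stepWeight_mul_pathWeight_le (n a b c : ℕ) :
    stepWeight a c * pathWeight n c b ≤ pathWeight (n + 1) a b := by
  rw [pathWeight_succ_eq_sum n a b (a + c + 2) (by omega)]
  exact Finset.single_le_sum
    (f := fun c => stepWeight a c * pathWeight n c b)
    (fun c _ => mul_nonneg (stepWeight_nonneg a c) (pathWeight_nonneg n c b))
    (Finset.mem_range.2 (by omega))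

lemma pathWeight_mul_le (m n a b c : ℕ) :
    pathWeight m a c * pathWeight n c b ≤ pathWeight (m + n) a b := by
  induction m generalizing a with
  | zero =>
    simp only [pathWeight, Nat.zero_add]
    split_ifs with h
    · simp [h]
    · simpa using pathWeight_nonneg n a b
  | succ m ih =>
    rw [show m + 1 + n = (m + n) + 1 by omega]
    simp only [pathWeight, Finset.sum_mul, mul_assoc]
    gcongr with d hd
    · exact stepWeight_nonneg a d
    · exact ih d

lemma pathWeight_succ_right (n a b K : ℕ) (hK : a + n + 1 ≤ K) :
    pathWeight (n + 1) a b = ∑ c ∈ Finset.range K, pathWeight n a c * stepWeight c b := by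
  induction n generalizing a with
  | zero =>
    rw [pathWeight_one]
    simp only [pathWeight, ite_mul, one_mul, zero_mul]
    rw [Finset.sum_ite_eq, if_pos (Finset.mem_range.2 (by omega))]
  | succ n ih =>
    have h : ∀ c ∈ Finset.range (a + 2), stepWeight a c * pathWeight (n + 1) c b =
        ∑ d ∈ Finset.range K, stepWeight a c * pathWeight n c d * stepWeight d b := by
      intro c hc
      rw [Finset.mem_range] at hc
      rw [ih c (by omega), Finset.mul_sum]
      simp only [mul_assoc]
    rw [pathWeight, Finset.sum_congr rfl h, Finset.sum_comm]
    simp only [pathWeight, Finset.sum_mul]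

lemma stepWeight_succ_succ (a b : ℕ) : stepWeight (a + 1) (b + 1) = stepWeight a b := by
  unfold stepWeight
  simp only [Nat.add_le_add_iff_right, Nat.add_sub_add_right]

lemma sum_stepWeight_succ (n a b : ℕ) :
    pathWeight (n + 1) (a + 1) b = stepWeight (a + 1) 0 * pathWeight n 0 b +
      ∑ c ∈ Finset.range (a + 2), stepWeight a c * pathWeight n (c + 1) b := by
  rw [pathWeight, Finset.sum_range_succ', add_comm]
  simp only [stepWeight_succ_succ]

lemma pathWeight_zero_eq_ite (a b : ℕ) : pathWeight 0 a b = if a = b then 1 else 0 := rfl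

/-- Inserting an excursion of height one at a visit to depth zero makes that visit identifiable. -/
lemma sum_pathWeight_mul_pathWeight_le (n a b : ℕ) :
    ∑ j ∈ Finset.range (n + 1), pathWeight j a 0 * pathWeight (n - j) 0 b ≤
      2 * pathWeight (n + 2) (a + 1) (b + 1) := by
  have hT10 : stepWeight 1 0 = 1 / 2 := by norm_num [stepWeight, Nat.factorial]
  have hT01 : stepWeight 0 1 = 1 := by norm_num [stepWeight]
  have shift : ∀ n a b, pathWeight n a b ≤ pathWeight n (a + 1) (b + 1) := by
    intro n
    induction n with
    | zero => intro a b; simp [pathWeight]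
    | succ n ih =>
      intro a b
      rw [sum_stepWeight_succ, pathWeight]
      have : ∑ c ∈ Finset.range (a + 2), stepWeight a c * pathWeight n c b ≤
          ∑ c ∈ Finset.range (a + 2), stepWeight a c * pathWeight n (c + 1) (b + 1) := by
        gcongr with c
        · exact stepWeight_nonneg a c
        · exact ih c b
      have h2 := mul_nonneg (stepWeight_nonneg (a + 1) 0) (pathWeight_nonneg n 0 (b + 1))
      linarith
  have base : ∀ n a, pathWeight 0 a 0 * pathWeight n 0 b ≤
      2 * (stepWeight (a + 1) 0 * pathWeight (n + 1) 0 (b + 1)) := by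
    intro n a
    have h0 := mul_nonneg (stepWeight_nonneg (a + 1) 0) (pathWeight_nonneg (n + 1) 0 (b + 1))
    rcases Nat.eq_zero_or_pos a with rfl | ha
    · have h1 := stepWeight_mul_pathWeight_le n 0 (b + 1) 1
      have h2 := shift n 0 b
      rw [hT01] at h1
      simp only [Nat.zero_add, hT10, pathWeight_zero_eq_ite, if_true] at *
      linarith
    · rw [pathWeight_zero_eq_ite, if_neg (by omega), zero_mul]
      linarith
  induction n generalizing a with
  | zero =>
    rw [Finset.sum_range_one, sum_stepWeight_succ]
    have h1 := base 0 a
    have h2 : 0 ≤ ∑ c ∈ Finset.range (a + 2), stepWeight a c * pathWeight (0 + 1) (c + 1) (b + 1) :=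
      Finset.sum_nonneg fun c _ => mul_nonneg (stepWeight_nonneg _ _) (pathWeight_nonneg _ _ _)
    simp only [Nat.sub_self, Nat.zero_add] at *
    linarith
  | succ n ih =>
    rw [Finset.sum_range_succ', sum_stepWeight_succ]
    have h1 := base (n + 1) a
    have h2 : ∑ j ∈ Finset.range (n + 1), pathWeight (j + 1) a 0 * pathWeight (n + 1 - (j + 1)) 0 b
        ≤ 2 * ∑ c ∈ Finset.range (a + 2),
          stepWeight a c * pathWeight (n + 2) (c + 1) (b + 1) := by
      calc _ = ∑ c ∈ Finset.range (a + 2), stepWeight a c *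
            ∑ j ∈ Finset.range (n + 1), pathWeight j c 0 * pathWeight (n - j) 0 b := by
            simp only [pathWeight, Nat.add_sub_add_right, Finset.sum_mul, Finset.mul_sum]
            rw [Finset.sum_comm]
            simp only [mul_assoc]
        _ ≤ _ := by
            rw [Finset.mul_sum]
            refine Finset.sum_le_sum fun c _ => ?_
            have := mul_le_mul_of_nonneg_left (ih c) (stepWeight_nonneg a c)
            linarith
    simp only [Nat.sub_zero] at *
    rw [show n + 1 + 1 = n + 2 from rfl] at *
    linarith

lemma sum_mul_pow_mul_choose (x : ℝ) (p : ℕ) :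
    ∑ i ∈ Finset.range (p + 1), (i : ℝ) * x ^ i * p.choose i = p * x * (x + 1) ^ (p - 1) := by
  cases p with
  | zero => simp
  | succ q =>
    rw [Finset.sum_range_succ', add_pow, Finset.mul_sum]
    simp only [Nat.cast_zero, zero_mul, add_zero, one_pow, mul_one, Nat.add_sub_cancel]
    refine Finset.sum_congr rfl fun i _ => ?_
    have h : ((q + 1 : ℕ) : ℝ) * q.choose i = (q + 1).choose (i + 1) * ((i + 1 : ℕ) : ℝ) := by
      exact_mod_cast Nat.add_one_mul_choose_eq q i
    rw [pow_succ]
    linear_combination (-x ^ i * x) * h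

lemma sum_sub_mul_pow_mul_choose (x : ℝ) (p : ℕ) :
    ∑ i ∈ Finset.range (p + 1), (x - i) * x ^ i * p.choose i =
      x * (x + 1) ^ p - p * x * (x + 1) ^ (p - 1) := by
  rw [← sum_mul_pow_mul_choose, add_pow, Finset.mul_sum, ← Finset.sum_sub_distrib]
  refine Finset.sum_congr rfl fun i _ => ?_
  simp only [one_pow, mul_one]
  ring

/-- The ballot formula for paths starting at depth zero. -/
lemma pathWeight_from_zero (n b : ℕ) (hb : b ≤ n) :
    pathWeight n 0 b = (b + 1) * (n + 1 : ℝ) ^ (n - b) / ((n + 1) * (n - b).factorial) := by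
  induction n generalizing b with
  | zero =>
    obtain rfl : b = 0 := by omega
    simp [pathWeight]
  | succ n ih =>
    obtain ⟨p, hp⟩ : ∃ p, p = n + 1 - b := ⟨_, rfl⟩
    set x : ℝ := (n : ℝ) + 1 with hx
    have hx0 : 0 < x := by positivity
    rw [pathWeight_succ_right n 0 b (n + 1) (by omega), ← Finset.sum_range_reflect]
    have key : ∀ i ∈ Finset.range (n + 1),
        pathWeight n 0 (n + 1 - 1 - i) * stepWeight (n + 1 - 1 - i) b =
          if i < p + 1 then (x - i) * x ^ i * p.choose i / (x * p.factorial) else 0 := by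
      intro i hi
      rw [Finset.mem_range] at hi
      simp only [Nat.add_sub_cancel]
      rw [ih (n - i) (by omega), Nat.sub_sub_self (by omega)]
      unfold stepWeight
      by_cases hip : i < p + 1
      · rw [if_pos (by omega), if_pos hip, show n - i + 1 - b = p - i by omega,
          Nat.cast_choose ℝ (show i ≤ p by omega), Nat.cast_sub (by omega)]
        field_simp
        rw [hx]
        ring
      · rw [if_neg (by omega), if_neg hip, mul_zero]
    rw [Finset.sum_congr rfl key, ← Finset.sum_filter]
    have hext : ∑ i ∈ Finset.range (n + 1) with i < p + 1,
        (x - i) * x ^ i * p.choose i / (x * p.factorial) =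
        ∑ i ∈ Finset.range (p + 1), (x - i) * x ^ i * p.choose i / (x * p.factorial) := by
      refine Finset.sum_subset (fun i hi => ?_) fun i hi hi' => ?_
      · simp only [Finset.mem_filter, Finset.mem_range] at hi ⊢
        exact hi.2
      · simp only [Finset.mem_filter, Finset.mem_range, not_and, not_lt] at hi hi'
        have : i = n + 1 := by
          by_contra h
          have := hi' (by omega)
          omega
        rw [this, hx]
        push_cast
        ring
    rw [hext, ← Finset.sum_div, sum_sub_mul_pow_mul_choose, ← hp]
    have hbx : (b : ℝ) = x - p := by
      have : b + p = n + 1 := by omega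
      have h2 : (b : ℝ) + p = n + 1 := by exact_mod_cast this
      rw [hx]; linarith
    have hx1 : x + 1 ≠ 0 := by positivity
    push_cast
    rw [← hx, hbx]
    rcases Nat.eq_zero_or_pos p with h0 | h0
    · rw [h0]
      simp only [Nat.cast_zero, pow_zero, Nat.factorial_zero, Nat.cast_one]
      field_simp
      ring
    · obtain ⟨q, rfl⟩ : ∃ q, p = q + 1 := ⟨p - 1, by omega⟩
      simp only [Nat.add_sub_cancel]
      field_simp
      rw [pow_succ]
      ring

/-- `k!` is at most a constant times `√k (k / e) ^ k`. -/
lemma factorial_le_stirling (n : ℕ) (hn : n ≠ 0) :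
    (n.factorial : ℝ) ≤ Real.exp 1 * Real.sqrt n * (n / Real.exp 1) ^ n := by
  obtain ⟨m, rfl⟩ := Nat.exists_eq_succ_of_ne_zero hn
  have h := Stirling.stirlingSeq'_antitone (Nat.zero_le m)
  simp only [Function.comp, Nat.succ_eq_add_one, Nat.zero_add, Stirling.stirlingSeq_one] at h
  unfold Stirling.stirlingSeq at h
  rw [div_le_iff₀ (by positivity)] at h
  refine h.trans (le_of_eq ?_)
  rw [Real.sqrt_mul (by norm_num)]
  have : Real.sqrt 2 ≠ 0 := by positivity
  field_simp

lemma pow_div_factorial_le (n i : ℕ) (hi : i ≤ n) :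
    (n : ℝ) ^ i / i.factorial ≤ (n : ℝ) ^ n / n.factorial := by
  induction n, hi using Nat.le_induction with
  | base => exact le_rfl
  | succ m hm ih =>
    clear ih
    have mono : ∀ j ≤ m + 1, ∀ x : ℝ, (m + 1 : ℝ) = x →
        x ^ j / j.factorial ≤ x ^ (m + 1) / (m + 1).factorial := by
      intro j hj x hx
      refine Nat.decreasingInduction' (P := fun j => x ^ j / j.factorial ≤
        x ^ (m + 1) / (m + 1).factorial) (fun l hl _ h => ?_) hj le_rfl
      refine le_trans ?_ h
      rw [Nat.factorial_succ, pow_succ]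
      push_cast
      have hl' : (l : ℝ) + 1 ≤ x := by
        rw [← hx]
        exact_mod_cast hl
      have hx0 : 0 ≤ x := le_trans (by positivity) hl'
      rw [div_le_div_iff₀ (by positivity) (by positivity)]
      have := mul_le_mul_of_nonneg_left hl'
        (show (0 : ℝ) ≤ x ^ l * l.factorial by positivity)
      linarith
    exact mono i (by omega) _ (by push_cast; rfl)

lemma pow_div_factorial_le_exp (n : ℕ) (hn : n ≠ 0) :
    (n : ℝ) ^ n / n.factorial ≤ Real.exp n / Real.sqrt n := by
  have hn0 : (0 : ℝ) < n := by exact_mod_cast Nat.pos_of_ne_zero hn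
  have h := Stirling.le_factorial_stirling n
  have h1 : Real.sqrt n ≤ Real.sqrt (2 * Real.pi * n) := by
    apply Real.sqrt_le_sqrt
    nlinarith [Real.pi_gt_three]
  have h2 : Real.sqrt n * (n / Real.exp 1) ^ n ≤ n.factorial :=
    le_trans (by gcongr) h
  rw [div_pow, ← Real.exp_nat_mul, mul_one] at h2
  rw [div_le_div_iff₀ (by positivity) (by positivity)]
  have h3 := mul_le_mul_of_nonneg_right h2 (Real.exp_pos n).le
  have : Real.sqrt n * ((n : ℝ) ^ n / Real.exp n) * Real.exp n = n ^ n * Real.sqrt n := by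
    field_simp
  linarith

lemma rpow_neg_three_halves (x : ℝ) (hx : 0 < x) :
    x ^ (-(3 / 2) : ℝ) = 1 / (x * Real.sqrt x) := by
  rw [Real.rpow_neg hx.le, one_div, show (3 / 2 : ℝ) = 1 + 1 / 2 by norm_num,
    Real.rpow_add hx, Real.rpow_one, ← Real.sqrt_eq_rpow]

lemma pathWeight_from_zero_le (n b : ℕ) :
    pathWeight n 0 b ≤
      (b + 1) * (Real.exp 1 * Real.exp n * ((n : ℝ) + 1) ^ (-(3 / 2) : ℝ)) := by
  rcases Nat.lt_or_ge n b with h | h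
  · rw [pathWeight_eq_zero (by omega)]
    positivity
  rw [pathWeight_from_zero n b h, rpow_neg_three_halves _ (by positivity)]
  have h1 := (pow_div_factorial_le (n + 1) (n - b) (by omega)).trans
    (pow_div_factorial_le_exp (n + 1) (by omega))
  push_cast at h1
  rw [Real.exp_add] at h1
  calc _ = ((b : ℝ) + 1) * (((n + 1 : ℝ) ^ (n - b) / (n - b).factorial) / (n + 1)) := by
        field_simp
    _ ≤ (b + 1) * ((Real.exp n * Real.exp 1 / Real.sqrt (n + 1)) / (n + 1)) := by gcongr
    _ = _ := by field_simp

lemma le_pathWeight_zero_zero (n : ℕ) :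
    Real.exp n * ((n : ℝ) + 1) ^ (-(3 / 2) : ℝ) ≤ pathWeight n 0 0 := by
  rw [pathWeight_from_zero n 0 (by omega), rpow_neg_three_halves _ (by positivity)]
  have h := factorial_le_stirling (n + 1) (by omega)
  rw [Nat.factorial_succ, div_pow, ← Real.exp_nat_mul] at h
  push_cast at h
  rw [mul_one, Real.exp_add] at h
  simp only [Nat.cast_zero, zero_add, one_mul, Nat.sub_zero]
  rw [mul_one_div, div_le_div_iff₀ (by positivity) (by positivity)]
  have h3 := mul_le_mul_of_nonneg_left h (Real.exp_pos n).le
  have : Real.exp n * (Real.exp 1 * Real.sqrt (n + 1) *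
      ((n + 1 : ℝ) ^ (n + 1) / (Real.exp n * Real.exp 1))) =
      (n + 1 : ℝ) ^ n * ((n + 1) * Real.sqrt (n + 1)) := by
    field_simp
    ring
  linarith

/-- A path of length `3 q + 2` that descends to depth `q` without rising above its start. -/
lemma exp_le_pathWeight_descent (q : ℕ) :
    ∃ L : ℕ, Real.exp L ≤ 12 * ((q : ℝ) + 1) * (5 / 4) ^ (q + 1) * pathWeight L 0 q := by
  refine ⟨3 * q + 2, ?_⟩
  rw [pathWeight_from_zero _ q (by omega), show 3 * q + 2 - q = 2 * (q + 1) by omega]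
  obtain ⟨p, hp⟩ : ∃ p, p = q + 1 := ⟨_, rfl⟩
  have hpq : (q : ℝ) + 1 = p := by rw [hp]; push_cast; ring
  have hp1 : (1 : ℝ) ≤ p := by rw [← hpq]; linarith [(Nat.cast_nonneg q : (0 : ℝ) ≤ q)]
  have h := factorial_le_stirling (2 * p) (by omega)
  have hs : Real.sqrt ((2 * p : ℕ) : ℝ) ≤ 2 * p := by
    rw [Real.sqrt_le_left (by positivity)]
    push_cast
    nlinarith
  rw [div_pow, ← Real.exp_nat_mul, mul_one] at h
  have he1 : Real.exp 1 < 2.7182818286 := Real.exp_one_lt_d9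
  have h2 : ((2 * p).factorial : ℝ) * Real.exp (2 * p) ≤ Real.exp 1 * (2 * p) * (2 * p) ^ (2 * p) := by
    have h3 : ((2 * p).factorial : ℝ) ≤ Real.exp 1 * (2 * p) *
        (((2 * p : ℕ) : ℝ) ^ (2 * p) / Real.exp ((2 * p : ℕ) : ℝ)) :=
      h.trans (by gcongr)
    push_cast at h3
    calc _ ≤ Real.exp 1 * (2 * p) * ((2 * p : ℝ) ^ (2 * p) / Real.exp (2 * p)) * Real.exp (2 * p) := by
          gcongr
      _ = _ := by field_simp
  rw [← hp, hpq]
  push_cast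
  rw [show (3 * (q : ℝ) + 2 + 1) = 3 * p by rw [← hpq]; ring,
    show (3 * (q : ℝ) + 2) = p + 2 * p - 1 by rw [← hpq]; ring]
  rw [show 12 * (p : ℝ) * (5 / 4) ^ p *
      (p * (3 * p) ^ (2 * p) / (3 * p * (2 * p).factorial)) =
      4 * p * (5 / 4) ^ p * (3 * p) ^ (2 * p) / (2 * p).factorial by field_simp; ring]
  rw [le_div_iff₀ (by positivity), Real.exp_sub, Real.exp_add]
  have hep : Real.exp p ≤ (5 / 4 : ℝ) ^ p * (9 / 4) ^ p := by
    rw [← mul_pow, ← mul_one (p : ℝ), Real.exp_nat_mul]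
    gcongr
    linarith
  calc Real.exp p * Real.exp (2 * p) / Real.exp 1 * (2 * p).factorial
      = Real.exp p / Real.exp 1 * ((2 * p).factorial * Real.exp (2 * p)) := by ring
    _ ≤ ((5 / 4 : ℝ) ^ p * (9 / 4) ^ p) / Real.exp 1 *
        (Real.exp 1 * (2 * p) * (2 * p) ^ (2 * p)) := by gcongr
    _ = 2 * p * (5 / 4 : ℝ) ^ p * ((9 / 4) ^ p * (2 * p) ^ (2 * p)) := by field_simp
    _ = 2 * p * (5 / 4 : ℝ) ^ p * (3 * p) ^ (2 * p) := by
        congr 1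
        rw [pow_mul, pow_mul, ← mul_pow]
        congr 1
        ring
    _ ≤ 4 * p * (5 / 4 : ℝ) ^ p * (3 * p) ^ (2 * p) := by gcongr; norm_num

lemma pathWeight_le :
    ∃ C : ℝ, 0 < C ∧ ∀ n a b : ℕ, pathWeight n a b ≤
      C * (b + 1) * ((a + 1) * (5 / 4) ^ a) * (Real.exp n * ((n : ℝ) + 1) ^ (-(3 / 2) : ℝ)) := by
  refine ⟨15 * Real.exp 1, by positivity, fun n a b => ?_⟩
  obtain ⟨L, hL⟩ := exp_le_pathWeight_descent a
  have hF : 0 < pathWeight L 0 a := by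
    by_contra h
    have := le_antisymm (not_lt.1 h) (pathWeight_nonneg L 0 a)
    rw [this, mul_zero] at hL
    exact absurd hL (not_le.2 (Real.exp_pos _))
  have h1 := (pathWeight_mul_le L n 0 b a).trans (pathWeight_from_zero_le (L + n) b)
  have h2 : (((L + n : ℕ) : ℝ) + 1) ^ (-(3 / 2) : ℝ) ≤ ((n : ℝ) + 1) ^ (-(3 / 2) : ℝ) := by
    apply Real.rpow_le_rpow_of_nonpos (by positivity) _ (by norm_num)
    push_cast
    linarith [(Nat.cast_nonneg L : (0 : ℝ) ≤ L)]
  set x := ((n : ℝ) + 1) ^ (-(3 / 2) : ℝ) with hx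
  have hx0 : 0 < x := by positivity
  refine le_of_mul_le_mul_left ?_ hF
  refine h1.trans ?_
  push_cast at h2 ⊢
  rw [Real.exp_add]
  calc _ ≤ ((b : ℝ) + 1) * (Real.exp 1 *
        ((12 * ((a : ℝ) + 1) * (5 / 4) ^ (a + 1) * pathWeight L 0 a) * Real.exp n) * x) := by
        gcongr
    _ = _ := by rw [pow_succ]; ring

/-- Position at time `t` of the path started at `z` whose `i`-th step is `1 - y i`. -/
def depth {n : ℕ} (z : ℤ) (y : Fin n → ℕ) (t : ℕ) : ℤ :=
  z + t - ∑ i : Fin n, if (i : ℕ) < t then (y i : ℤ) else 0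

/-- The product of the inverse factorials of the entries of `y`. -/
def invFactorials {n : ℕ} (y : Fin n → ℕ) : ENNReal := ∏ i, ((y i).factorial : ENNReal)⁻¹

lemma depth_zero {n : ℕ} (z : ℤ) (y : Fin n → ℕ) : depth z y 0 = z := by simp [depth]

lemma depth_cons {n : ℕ} (z : ℤ) (x : ℕ) (y : Fin n → ℕ) (t : ℕ) :
    depth z (Fin.cons x y : Fin (n + 1) → ℕ) (t + 1) = depth (z + 1 - x) y t := by
  simp [depth, Fin.sum_univ_succ]
  ring

lemma ofReal_inv_factorial (k : ℕ) :
    ENNReal.ofReal ((k.factorial : ℝ)⁻¹) = (k.factorial : ENNReal)⁻¹ := by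
  rw [ENNReal.ofReal_inv_of_pos (by positivity), ENNReal.ofReal_natCast]

lemma ofReal_stepWeight_mul (a c : ℕ) (x : ℝ) :
    ENNReal.ofReal (stepWeight a c * x) = ENNReal.ofReal (stepWeight a c) * ENNReal.ofReal x :=
  ENNReal.ofReal_mul (stepWeight_nonneg a c)

lemma invFactorials_cons {n : ℕ} (x : ℕ) (y : Fin n → ℕ) :
    invFactorials (Fin.cons x y : Fin (n + 1) → ℕ) =
      (x.factorial : ENNReal)⁻¹ * invFactorials y := by
  simp [invFactorials, Fin.prod_univ_succ]

lemma tsum_fin_succ {n : ℕ} (f : (Fin (n + 1) → ℕ) → ENNReal) :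
    ∑' y, f y = ∑' x : ℕ, ∑' y : Fin n → ℕ, f (Fin.cons x y) := by
  rw [← (Fin.consEquiv fun _ : Fin (n + 1) => ℕ).tsum_eq, ENNReal.tsum_prod']
  rfl

lemma tsum_ite_step {n : ℕ} (a : ℕ) (p : ℤ → (Fin n → ℕ) → Prop) [∀ z y, Decidable (p z y)]
    (hp : ∀ z y, p z y → 0 ≤ z) :
    ∑' y : Fin (n + 1) → ℕ, (if p (a + 1 - y 0) (Fin.tail y) then invFactorials y else 0) =
      ∑ c ∈ Finset.range (a + 2), ENNReal.ofReal (stepWeight a c) *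
        ∑' y : Fin n → ℕ, if p c y then invFactorials y else 0 := by
  rw [tsum_fin_succ, tsum_eq_sum (s := Finset.range (a + 2)), ← Finset.sum_range_reflect]
  · refine Finset.sum_congr rfl fun c hc => ?_
    rw [Finset.mem_range] at hc
    rw [← ENNReal.tsum_mul_left]
    refine tsum_congr fun y => ?_
    rw [stepWeight, if_pos (show c ≤ a + 1 by omega), ofReal_inv_factorial, mul_ite, mul_zero,
      invFactorials_cons, Fin.cons_zero, Fin.tail_cons]
    have h1 : a + 2 - 1 - c = a + 1 - c := by omega
    have h2 : (a : ℤ) + 1 - ((a + 1 - c : ℕ) : ℤ) = c := by omega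
    rw [h1, h2]
  · intro x hx
    rw [Finset.mem_range, not_lt] at hx
    refine ENNReal.tsum_eq_zero.2 fun y => if_neg fun h => ?_
    have := hp _ _ h
    rw [Fin.cons_zero] at this
    omega

lemma tsum_stay (n a c : ℕ) :
    ∑' y : Fin n → ℕ, (if (∀ t ≤ n, 0 ≤ depth a y t) ∧ depth a y n = c
      then invFactorials y else 0) = ENNReal.ofReal (pathWeight n a c) := by
  induction n generalizing a with
  | zero =>
    rw [tsum_eq_single default fun y hy => absurd (Subsingleton.elim y default) hy]
    simp [depth, invFactorials, pathWeight]
    split_ifs <;> simp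
  | succ n ih =>
    have h := tsum_ite_step a
      (fun z (y : Fin n → ℕ) => (∀ t ≤ n, 0 ≤ depth z y t) ∧ depth z y n = c)
      (fun z y h => by simpa [depth_zero] using h.1 0 (Nat.zero_le _))
    simp only [ih] at h
    rw [pathWeight, ENNReal.ofReal_sum_of_nonneg
      fun c _ => mul_nonneg (stepWeight_nonneg _ _) (pathWeight_nonneg _ _ _)]
    simp only [ofReal_stepWeight_mul]
    rw [← h]
    refine tsum_congr fun y => ?_
    obtain ⟨x, y', rfl⟩ : ∃ x y', y = Fin.cons x y' := ⟨y 0, Fin.tail y, (Fin.cons_self_tail y).symm⟩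
    rw [Fin.cons_zero, Fin.tail_cons, depth_cons]
    refine if_congr (and_congr_left fun _ => ⟨fun h t ht => ?_, fun h t ht => ?_⟩) rfl rfl
    · simpa [depth_cons] using h (t + 1) (by omega)
    · cases t with
      | zero => simp [depth_zero]
      | succ t => simpa [depth_cons] using h t (by omega)

lemma tsum_stay_through (n j a b c : ℕ) (hj : j ≤ n) :
    ∑' y : Fin n → ℕ, (if (∀ t ≤ n, 0 ≤ depth a y t) ∧ depth a y j = b ∧ depth a y n = c
      then invFactorials y else 0) =
      ENNReal.ofReal (pathWeight j a b * pathWeight (n - j) b c) := by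
  induction n generalizing a j with
  | zero =>
    obtain rfl : j = 0 := by omega
    rw [tsum_eq_single default fun y hy => absurd (Subsingleton.elim y default) hy]
    simp [depth, invFactorials, pathWeight]
    split_ifs <;> first | omega | simp_all
  | succ n ih =>
    cases j with
    | zero =>
      simp only [depth_zero, pathWeight, Nat.sub_zero]
      by_cases hab : a = b
      · subst hab
        simp only [true_and, if_true, one_mul]
        exact tsum_stay (n + 1) a c
      · have : ¬ ((a : ℤ) = b) := by exact_mod_cast hab
        simp [hab]
    | succ j =>
      have h := tsum_ite_step a
        (fun z (y : Fin n → ℕ) => (∀ t ≤ n, 0 ≤ depth z y t) ∧ depth z y j = b ∧ depth z y n = c)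
        (fun z y h => by simpa [depth_zero] using h.1 0 (Nat.zero_le _))
      simp only [ih j _ (by omega : j ≤ n)] at h
      rw [pathWeight, Finset.sum_mul, ENNReal.ofReal_sum_of_nonneg fun c _ => mul_nonneg
        (mul_nonneg (stepWeight_nonneg _ _) (pathWeight_nonneg _ _ _)) (pathWeight_nonneg _ _ _)]
      simp only [mul_assoc, ofReal_stepWeight_mul, Nat.add_sub_add_right]
      rw [← h]
      refine tsum_congr fun y => ?_
      obtain ⟨x, y', rfl⟩ : ∃ x y', y = Fin.cons x y' :=
        ⟨y 0, Fin.tail y, (Fin.cons_self_tail y).symm⟩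
      rw [Fin.cons_zero, Fin.tail_cons, depth_cons, depth_cons]
      refine if_congr (and_congr_left fun _ => ⟨fun h t ht => ?_, fun h t ht => ?_⟩) rfl rfl
      · simpa [depth_cons] using h (t + 1) (by omega)
      · cases t with
        | zero => simp [depth_zero]
        | succ t => simpa [depth_cons] using h t (by omega)

/-- Marking one unit of the step `i`, and deleting it, deepens the path by one after time `i`. -/
lemma tsum_marked_le (n j m r : ℕ) (i : Fin n) (hij : (i : ℕ) < j) (hj : j ≤ n) :
    ∑' y : Fin n → ℕ, (if (∀ t ≤ n, 0 ≤ depth m y t) ∧ depth m y j = 0 ∧ depth m y n = r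
      then (y i : ENNReal) * invFactorials y else 0) ≤
      ENNReal.ofReal (pathWeight j m 1 * pathWeight (n - j) 1 (r + 1)) := by
  let g : (Fin n → ℕ) → (Fin n → ℕ) := fun y => Function.update y i (y i + 1)
  have hg : Function.Injective g := by
    intro y y' h
    funext l
    have := congrFun h l
    by_cases hl : l = i
    · subst hl
      simpa [g] using this
    · simpa [g, hl] using this
  have hdepth : ∀ y t, depth m y t = depth m (g y) t + if (i : ℕ) < t then 1 else 0 := by
    intro y t
    have : ∀ l : Fin n, (if (l : ℕ) < t then ((g y l : ℕ) : ℤ) else 0) =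
        (if (l : ℕ) < t then (y l : ℤ) else 0) + if l = i then (if (i : ℕ) < t then 1 else 0) else 0 := by
      intro l
      by_cases hl : l = i
      · subst hl
        simp only [g, Function.update_self, if_true]
        split_ifs <;> simp
      · simp [g, hl]
    simp only [depth, this, Finset.sum_add_distrib, Finset.sum_ite_eq', Finset.mem_univ, if_true]
    ring
  have hw : ∀ y : Fin n → ℕ, ((g y i : ℕ) : ENNReal) * invFactorials (g y) = invFactorials y := by
    intro y
    unfold invFactorials
    rw [← Finset.mul_prod_erase _ _ (Finset.mem_univ i),
      ← Finset.mul_prod_erase _ (fun l => ((y l).factorial : ENNReal)⁻¹) (Finset.mem_univ i),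
      ← mul_assoc]
    congr 1
    · simp only [g, Function.update_self]
      rw [Nat.factorial_succ, Nat.cast_mul, ENNReal.mul_inv (Or.inr (ENNReal.natCast_ne_top _))
        (Or.inl (ENNReal.natCast_ne_top _)), ← mul_assoc, ENNReal.mul_inv_cancel, one_mul]
      · exact_mod_cast Nat.succ_ne_zero (y i)
      · exact ENNReal.natCast_ne_top _
    · refine Finset.prod_congr rfl fun l hl => ?_
      rw [Finset.mem_erase] at hl
      simp [g, hl.1]
  rw [← hg.tsum_eq]
  · have h := tsum_stay_through n j m 1 (r + 1) hj
    rw [← h]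
    refine ENNReal.tsum_le_tsum fun y => ?_
    rw [hw]
    by_cases hc : (∀ t ≤ n, 0 ≤ depth m (g y) t) ∧ depth m (g y) j = 0 ∧ depth m (g y) n = r
    · rw [if_pos hc, if_pos]
      refine ⟨fun t ht => ?_, ?_, ?_⟩
      · rw [hdepth]
        have := hc.1 t ht
        split_ifs <;> omega
      · rw [hdepth, if_pos hij, hc.2.1]
        simp
      · rw [hdepth, if_pos (by omega), hc.2.2]
        simp
    · rw [if_neg hc]
      exact zero_le
  · intro y hy
    rw [Function.mem_support] at hy
    have h0 : y i ≠ 0 := by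
      intro h0
      apply hy
      simp [h0]
    refine ⟨Function.update y i (y i - 1), ?_⟩
    funext l
    by_cases hl : l = i
    · subst hl
      simp only [g, Function.update_self]
      omega
    · simp [g, hl]

lemma sum_pathWeight_convolution_le :
    ∃ C : ℝ, 0 < C ∧ ∀ n m r : ℕ,
      ∑ j ∈ Finset.range (n + 1), (pathWeight j m 0 * pathWeight (n - j) 0 r +
        2 * (pathWeight j m 1 * pathWeight (n - j) 1 (r + 1))) ≤
      C * ((Real.exp n * ((n : ℝ) + 1) ^ (-(3 / 2) : ℝ)) *
        ((((m : ℝ) + 2) * (5 / 4) ^ m) * ((r : ℝ) + 3))) := by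
  obtain ⟨C, hC, hF⟩ := pathWeight_le
  refine ⟨2 * (C * (5 / 4) * Real.exp 2) + 8 * (C * (5 / 4) * Real.exp 4), by positivity,
    fun n m r => ?_⟩
  have h1 := sum_pathWeight_mul_pathWeight_le n m r
  have h2 := sum_pathWeight_mul_pathWeight_le (n + 2) m (r + 1)
  have hT10 : stepWeight 1 0 = 1 / 2 := by norm_num [stepWeight, Nat.factorial]
  have hT01 : stepWeight 0 1 = 1 := by norm_num [stepWeight]
  have h3 : ∑ j ∈ Finset.range (n + 1), 2 * (pathWeight j m 1 * pathWeight (n - j) 1 (r + 1)) ≤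
      4 * ∑ j ∈ Finset.range (n + 2 + 1), pathWeight j m 0 * pathWeight (n + 2 - j) 0 (r + 1) := by
    calc _ ≤ 4 * ∑ j ∈ Finset.range (n + 1),
          pathWeight (j + 1) m 0 * pathWeight (n + 2 - (j + 1)) 0 (r + 1) := by
          rw [Finset.mul_sum]
          refine Finset.sum_le_sum fun j hj => ?_
          rw [Finset.mem_range] at hj
          have ha : pathWeight j m 1 ≤ 2 * pathWeight (j + 1) m 0 := by
            have := pathWeight_mul_le j 1 m 0 1
            rw [pathWeight_one, hT10] at this
            linarith
          have hb : pathWeight (n - j) 1 (r + 1) ≤ pathWeight (n + 2 - (j + 1)) 0 (r + 1) := by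
            have := stepWeight_mul_pathWeight_le (n - j) 0 (r + 1) 1
            rw [hT01, one_mul] at this
            rwa [show n + 2 - (j + 1) = n - j + 1 by omega]
          have := mul_le_mul ha hb (pathWeight_nonneg _ _ _)
            (mul_nonneg zero_le_two (pathWeight_nonneg _ _ _))
          linarith
      _ ≤ _ := by
          rw [Finset.sum_range_succ' _ (n + 2), Finset.sum_range_succ _ (n + 1)]
          have e1 := mul_nonneg (pathWeight_nonneg (n + 1 + 1) m 0)
            (pathWeight_nonneg (n + 2 - (n + 1 + 1)) 0 (r + 1))
          have e2 := mul_nonneg (pathWeight_nonneg 0 m 0)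
            (pathWeight_nonneg (n + 2 - 0) 0 (r + 1))
          linarith
  rw [Finset.sum_add_distrib]
  have hbound : ∀ l s : ℕ, s ≤ r + 2 → pathWeight (n + l) (m + 1) s ≤
      (C * (5 / 4) * Real.exp l) * ((Real.exp n * ((n : ℝ) + 1) ^ (-(3 / 2) : ℝ)) *
        ((((m : ℝ) + 2) * (5 / 4) ^ m) * ((r : ℝ) + 3))) := by
    intro l s hs
    refine (hF (n + l) (m + 1) s).trans ?_
    have hs' : (s : ℝ) + 1 ≤ r + 3 := by
      have : (s : ℝ) ≤ ((r + 2 : ℕ) : ℝ) := by exact_mod_cast hs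
      push_cast at this
      linarith
    have hp : (((n + l : ℕ) : ℝ) + 1) ^ (-(3 / 2) : ℝ) ≤ ((n : ℝ) + 1) ^ (-(3 / 2) : ℝ) := by
      apply Real.rpow_le_rpow_of_nonpos (by positivity) _ (by norm_num)
      push_cast
      linarith [(Nat.cast_nonneg l : (0 : ℝ) ≤ l)]
    set x := ((n : ℝ) + 1) ^ (-(3 / 2) : ℝ) with hx
    have hx0 : 0 < x := by positivity
    push_cast at hp ⊢
    rw [Real.exp_add]
    calc _ ≤ C * ((r : ℝ) + 3) * (((m : ℝ) + 1 + 1) * (5 / 4) ^ (m + 1)) *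
          ((Real.exp n * Real.exp l) * x) := by gcongr
      _ = _ := by rw [pow_succ]; ring
  have h4 := hbound 2 (r + 1) (by omega)
  have h5 := hbound 4 (r + 1 + 1) (by omega)
  rw [show n + 2 + 2 = n + 4 by omega] at h2
  push_cast at h4 h5
  linarith

lemma sum_two_pow_div_le (n j : ℕ) :
    ∑ i : Fin n, (if (i : ℕ) < j then (2 : ℝ) ^ ((i : ℕ) + 1) / 2 ^ j else 0) ≤ 2 := by
  rw [Fin.sum_univ_eq_sum_range (fun i => if i < j then (2 : ℝ) ^ (i + 1) / 2 ^ j else 0),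
    ← Finset.sum_filter]
  calc _ ≤ ∑ i ∈ Finset.range j, (2 : ℝ) ^ (i + 1) / 2 ^ j := by
        refine Finset.sum_le_sum_of_subset_of_nonneg (fun i hi => ?_) fun i _ _ => by positivity
        simp only [Finset.mem_filter, Finset.mem_range] at hi ⊢
        exact hi.2
    _ = 2 * (∑ i ∈ Finset.range j, (2 : ℝ) ^ i) / 2 ^ j := by
        rw [Finset.mul_sum, Finset.sum_div]
        exact Finset.sum_congr rfl fun i _ => by rw [pow_succ]; ring
    _ ≤ 2 := by
        rw [geom_sum_eq (by norm_num), div_le_iff₀ (by positivity)]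
        norm_num

lemma summable_add_mul_geometric (c x : ℝ) (hx0 : 0 ≤ x) (hx1 : x < 1) :
    Summable fun m : ℕ => ((m : ℝ) + c) * x ^ m := by
  simp only [add_mul]
  refine Summable.add ?_ ((summable_geometric_of_lt_one hx0 hx1).mul_left c)
  simpa using summable_pow_mul_geometric_of_norm_lt_one 1
    (show ‖x‖ < 1 by rwa [Real.norm_of_nonneg hx0])

/-- The linear functional bounding the number of subset sums at the time `j`. -/
def partialMass {n : ℕ} (y : Fin n → ℕ) (j : ℕ) : ENNReal :=
  1 + ∑ i : Fin n, (if (i : ℕ) < j then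
    ENNReal.ofReal ((2 : ℝ) ^ ((i : ℕ) + 1) / 2 ^ j) * (y i : ENNReal) else 0)

lemma tsum_partialMass_le (n j m r : ℕ) (hj : j ≤ n) :
    ∑' y : Fin n → ℕ, (if (∀ t ≤ n, 0 ≤ depth m y t) ∧ depth m y j = 0 ∧ depth m y n = r
      then partialMass y j * invFactorials y else 0) ≤
      ENNReal.ofReal (pathWeight j m 0 * pathWeight (n - j) 0 r +
        2 * (pathWeight j m 1 * pathWeight (n - j) 1 (r + 1))) := by
  have hnn : ∀ a b c a' b' c', 0 ≤ pathWeight a b c * pathWeight a' b' c' :=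
    fun a b c a' b' c' => mul_nonneg (pathWeight_nonneg _ _ _) (pathWeight_nonneg _ _ _)
  have hsplit : ∀ y : Fin n → ℕ,
      (if (∀ t ≤ n, 0 ≤ depth m y t) ∧ depth m y j = 0 ∧ depth m y n = r
        then partialMass y j * invFactorials y else 0) =
      (if (∀ t ≤ n, 0 ≤ depth m y t) ∧ depth m y j = 0 ∧ depth m y n = r
        then invFactorials y else 0) +
      ∑ i : Fin n, (if (i : ℕ) < j then ENNReal.ofReal ((2 : ℝ) ^ ((i : ℕ) + 1) / 2 ^ j) else 0) *
        (if (∀ t ≤ n, 0 ≤ depth m y t) ∧ depth m y j = 0 ∧ depth m y n = r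
          then (y i : ENNReal) * invFactorials y else 0) := by
    intro y
    by_cases hc : (∀ t ≤ n, 0 ≤ depth m y t) ∧ depth m y j = 0 ∧ depth m y n = r
    · simp only [if_pos hc, partialMass, add_mul, one_mul, Finset.sum_mul]
      congr 1
      refine Finset.sum_congr rfl fun i _ => ?_
      split_ifs
      · ring
      · simp
    · simp only [if_neg hc, mul_zero, Finset.sum_const_zero, add_zero]
  simp only [hsplit]
  have h0 := tsum_stay_through n j m 0 r hj
  simp only [Nat.cast_zero] at h0
  rw [ENNReal.tsum_add, h0, Summable.tsum_finsetSum fun _ _ => ENNReal.summable,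
    ENNReal.ofReal_add (hnn _ _ _ _ _ _) (mul_nonneg zero_le_two (hnn _ _ _ _ _ _))]
  refine add_le_add le_rfl ?_
  calc _ ≤ ∑ i : Fin n, ENNReal.ofReal
        (if (i : ℕ) < j then (2 : ℝ) ^ ((i : ℕ) + 1) / 2 ^ j else 0) *
          ENNReal.ofReal (pathWeight j m 1 * pathWeight (n - j) 1 (r + 1)) := by
        refine Finset.sum_le_sum fun i _ => ?_
        rw [ENNReal.tsum_mul_left]
        by_cases hij : (i : ℕ) < j
        · rw [if_pos hij, if_pos hij]
          gcongr
          exact tsum_marked_le n j m r i hij hj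
        · simp [hij]
    _ ≤ _ := by
        rw [← Finset.sum_mul, ← ENNReal.ofReal_sum_of_nonneg,
          ENNReal.ofReal_mul zero_le_two]
        · gcongr
          exact sum_two_pow_div_le n j
        · intro i _
          split_ifs <;> positivity

/-- Cutting at the time when the path is lowest. -/
lemma exists_cut_bound {n : ℕ} (y : Fin n → ℕ) (B : ℝ)
    (hB : ∀ j ≤ n, B ≤ 2 ^ (∑ i : Fin n, if (i : ℕ) < j then 0 else y i) *
      (1 + ∑ i : Fin n, if (i : ℕ) < j then 2 ^ ((i : ℕ) + 1) * (y i : ℝ) else 0)) :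
    ∃ j m r : ℕ, j ≤ n ∧
      ((∀ t ≤ n, 0 ≤ depth m y t) ∧ depth m y j = 0 ∧ depth m y n = r) ∧
      ENNReal.ofReal (Real.log 2 ^ (∑ i, y i) * B) ≤
        ENNReal.ofReal ((2 * Real.log 2) ^ n * (Real.log 2 ^ m * (2 * Real.log 2)⁻¹ ^ r)) *
          partialMass y j := by
  have hlog : 0 < Real.log 2 := Real.log_pos (by norm_num)
  obtain ⟨j, hj, hmin⟩ := Finset.exists_min_image (Finset.range (n + 1)) (depth 0 y)
    ⟨0, Finset.mem_range.2 (by omega)⟩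
  rw [Finset.mem_range] at hj
  have hd : ∀ (m : ℤ) t, depth m y t = m + depth 0 y t := fun m t => by simp only [depth]; ring
  have h0 := hmin 0 (Finset.mem_range.2 (by omega))
  rw [depth_zero] at h0
  obtain ⟨m, hm⟩ := Int.eq_ofNat_of_zero_le (a := -depth 0 y j) (by omega)
  have hstay : ∀ t ≤ n, 0 ≤ depth m y t := by
    intro t ht
    have := hmin t (Finset.mem_range.2 (by omega))
    rw [hd]
    omega
  obtain ⟨r, hr⟩ := Int.eq_ofNat_of_zero_le (hstay n le_rfl)
  have hj0 : depth m y j = 0 := by rw [hd]; omega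
  refine ⟨j, m, r, by omega, ⟨hstay, hj0, hr⟩, ?_⟩
  obtain ⟨U, hU⟩ : ∃ U, U = ∑ i : Fin n, if (i : ℕ) < j then 0 else y i := ⟨_, rfl⟩
  obtain ⟨V, hV⟩ : ∃ V, V = ∑ i : Fin n, if (i : ℕ) < j then y i else 0 := ⟨_, rfl⟩
  have hUV : ∑ i, y i = V + U := by
    rw [hU, hV, ← Finset.sum_add_distrib]
    exact Finset.sum_congr rfl fun i _ => by split_ifs <;> simp
  have hn1 : ((m : ℤ) + n - ∑ i, (y i : ℤ)) = r := by
    rw [← hr]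
    simp [depth]
  have hj1 : V = m + j := by
    have : (m : ℤ) + j - ∑ i : Fin n, (if (i : ℕ) < j then (y i : ℤ) else 0) = 0 := hj0
    have hVz : (V : ℤ) = ∑ i : Fin n, (if (i : ℕ) < j then (y i : ℤ) else 0) := by
      rw [hV]; push_cast; rfl
    omega
  have hN : (∑ i, y i) + r = m + n := by
    have : ((∑ i, y i : ℕ) : ℤ) = ∑ i, (y i : ℤ) := by push_cast; rfl
    omega
  have hU1 : U + r + j = n := by omega
  have hBj := hB j (by omega)
  rw [← hU] at hBj
  set W := ∑ i : Fin n, (if (i : ℕ) < j then 2 ^ ((i : ℕ) + 1) * (y i : ℝ) else 0) with hW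
  have hW0 : 0 ≤ W := Finset.sum_nonneg fun i _ => by split_ifs <;> positivity
  have hmass : ENNReal.ofReal (1 + W / 2 ^ j) = partialMass y j := by
    rw [partialMass, ENNReal.ofReal_add zero_le_one (by positivity), ENNReal.ofReal_one, hW,
      Finset.sum_div, ENNReal.ofReal_sum_of_nonneg fun i _ => by split_ifs <;> positivity]
    congr 1
    refine Finset.sum_congr rfl fun i _ => ?_
    split_ifs
    · rw [← ENNReal.ofReal_natCast (y i), ← ENNReal.ofReal_mul (by positivity)]
      congr 1
      ring
    · simp
  rw [← hmass, ← ENNReal.ofReal_mul (by positivity)]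
  apply ENNReal.ofReal_le_ofReal
  calc Real.log 2 ^ (∑ i, y i) * B ≤ Real.log 2 ^ (∑ i, y i) * (2 ^ U * (1 + W)) := by gcongr
    _ = ((2 * Real.log 2) ^ n * (Real.log 2 ^ m * (2 * Real.log 2)⁻¹ ^ r)) *
        (1 / 2 ^ j + W / 2 ^ j) := by
        have e1 : Real.log 2 ^ (∑ i, y i) * Real.log 2 ^ r = Real.log 2 ^ m * Real.log 2 ^ n := by
          rw [← pow_add, hN, pow_add]
        have e2 : (2 : ℝ) ^ U * 2 ^ r * 2 ^ j = 2 ^ n := by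
          rw [← pow_add, ← pow_add, hU1]
        rw [inv_pow, mul_pow, mul_pow, ← e2]
        field_simp
        linear_combination e1
    _ ≤ _ := by
        gcongr
        rw [div_le_one (by positivity)]
        exact one_le_pow₀ (by norm_num)

lemma tsum_path_upper :
    ∃ C : ℝ, 0 < C ∧ ∀ (n : ℕ) (B : (Fin n → ℕ) → ℝ),
      (∀ y, ∀ j ≤ n, B y ≤ 2 ^ (∑ i : Fin n, if (i : ℕ) < j then 0 else y i) *
        (1 + ∑ i : Fin n, if (i : ℕ) < j then 2 ^ ((i : ℕ) + 1) * (y i : ℝ) else 0)) →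
      ∑' y : Fin n → ℕ, ENNReal.ofReal (Real.log 2 ^ (∑ i, y i) * B y) * invFactorials y ≤
        ENNReal.ofReal (C * ((2 * Real.log 2) ^ n *
          (Real.exp n * ((n : ℝ) + 1) ^ (-(3 / 2) : ℝ)))) := by
  obtain ⟨C, hC, hF⟩ := sum_pathWeight_convolution_le
  have hl1 : Real.log 2 < 0.6931471808 := Real.log_two_lt_d9
  have hl2 : 0.6931471803 < Real.log 2 := Real.log_two_gt_d9
  have hs1 := summable_add_mul_geometric 2 (Real.log 2 * (5 / 4)) (by linarith) (by linarith)
  have hs2 := summable_add_mul_geometric 3 (2 * Real.log 2)⁻¹ (by positivity)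
    (inv_lt_one_of_one_lt₀ (by linarith))
  set S1 := ∑' m : ℕ, ((m : ℝ) + 2) * (Real.log 2 * (5 / 4)) ^ m with hS1
  set S2 := ∑' r : ℕ, ((r : ℝ) + 3) * (2 * Real.log 2)⁻¹ ^ r with hS2
  have hlog : 0 < Real.log 2 := by linarith
  have hS1p : 0 < S1 := hs1.tsum_pos (fun m => by positivity) 0 (by norm_num)
  have hS2p : 0 < S2 := hs2.tsum_pos (fun m => by positivity) 0 (by norm_num)
  refine ⟨C * (S1 * S2), by positivity, fun n B hB => ?_⟩
  set K := (2 * Real.log 2) ^ n with hK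
  set X := Real.exp n * ((n : ℝ) + 1) ^ (-(3 / 2) : ℝ) with hX
  have hK0 : 0 < K := by positivity
  have hX0 : 0 < X := by positivity
  let coef : ℕ → ℕ → ENNReal := fun m r =>
    ENNReal.ofReal (K * (Real.log 2 ^ m * (2 * Real.log 2)⁻¹ ^ r))
  let term : ℕ → ℕ → ℕ → (Fin n → ℕ) → ENNReal := fun m r j y =>
    if (∀ t ≤ n, 0 ≤ depth m y t) ∧ depth m y j = 0 ∧ depth m y n = r
      then partialMass y j * invFactorials y else 0
  have hpoint : ∀ y : Fin n → ℕ,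
      ENNReal.ofReal (Real.log 2 ^ (∑ i, y i) * B y) * invFactorials y ≤
        ∑' m, ∑' r, coef m r * ∑ j ∈ Finset.range (n + 1), term m r j y := by
    intro y
    obtain ⟨j, m, r, hj, hcond, hle⟩ := exists_cut_bound y (B y) (hB y)
    refine le_trans ?_ (ENNReal.le_tsum m)
    refine le_trans ?_ (ENNReal.le_tsum r)
    calc _ ≤ coef m r * partialMass y j * invFactorials y := by gcongr
      _ = coef m r * term m r j y := by
          simp only [term]
          rw [if_pos hcond, mul_assoc]
      _ ≤ _ := by
          gcongr
          exact Finset.single_le_sum (f := fun j => term m r j y) (fun _ _ => zero_le)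
            (Finset.mem_range.2 (by omega))
  calc _ ≤ ∑' y, ∑' m, ∑' r, coef m r * ∑ j ∈ Finset.range (n + 1), term m r j y :=
        ENNReal.tsum_le_tsum hpoint
    _ = ∑' m, ∑' r, coef m r * ∑ j ∈ Finset.range (n + 1), ∑' y, term m r j y := by
        rw [ENNReal.tsum_comm]
        refine tsum_congr fun m => ?_
        rw [ENNReal.tsum_comm]
        refine tsum_congr fun r => ?_
        rw [ENNReal.tsum_mul_left, Summable.tsum_finsetSum fun _ _ => ENNReal.summable]
    _ ≤ ∑' m : ℕ, ∑' r : ℕ, ENNReal.ofReal (C * (K * X)) *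
        (ENNReal.ofReal (((m : ℝ) + 2) * (Real.log 2 * (5 / 4)) ^ m) *
          ENNReal.ofReal (((r : ℝ) + 3) * (2 * Real.log 2)⁻¹ ^ r)) := by
        refine ENNReal.tsum_le_tsum fun m => ENNReal.tsum_le_tsum fun r => ?_
        calc _ ≤ coef m r * ∑ j ∈ Finset.range (n + 1),
              ENNReal.ofReal (pathWeight j m 0 * pathWeight (n - j) 0 r +
                2 * (pathWeight j m 1 * pathWeight (n - j) 1 (r + 1))) := by
              gcongr with j hj
              exact tsum_partialMass_le n j m r (by rw [Finset.mem_range] at hj; omega)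
          _ ≤ coef m r * ENNReal.ofReal
              (C * (X * ((((m : ℝ) + 2) * (5 / 4) ^ m) * ((r : ℝ) + 3)))) := by
              rw [← ENNReal.ofReal_sum_of_nonneg]
              · gcongr
                exact hF n m r
              · intro j _
                have h1 := pathWeight_nonneg
                exact add_nonneg (mul_nonneg (h1 _ _ _) (h1 _ _ _))
                  (mul_nonneg zero_le_two (mul_nonneg (h1 _ _ _) (h1 _ _ _)))
          _ = _ := by
              simp only [coef]
              rw [← ENNReal.ofReal_mul (by positivity), ← ENNReal.ofReal_mul (by positivity),
                ← ENNReal.ofReal_mul (by positivity)]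
              congr 1
              rw [mul_pow (Real.log 2)]
              ring
    _ = ENNReal.ofReal (C * (S1 * S2) * (K * X)) := by
        simp only [ENNReal.tsum_mul_left, ENNReal.tsum_mul_right]
        rw [← ENNReal.ofReal_tsum_of_nonneg (fun m => by positivity) hs1,
          ← ENNReal.ofReal_tsum_of_nonneg (fun m => by positivity) hs2,
          ← ENNReal.ofReal_mul (by positivity), ← ENNReal.ofReal_mul (by positivity)]
        congr 1
        ring

/-- The sums of `c` over the blocks into which `β` partitions the index set. -/
def blockSums {ι κ : Type*} [Fintype ι] [DecidableEq κ] (β : ι → κ) (c : ι → ℕ) : κ → ℕ :=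
  fun j => ∑ i with β i = j, c i

/-- The vectors with prescribed sums over the blocks given by `β`. -/
def blockFiber {ι κ : Type*} [Fintype ι] [DecidableEq ι] [Fintype κ] [DecidableEq κ]
    (β : ι → κ) (y : κ → ℕ) : Finset (ι → ℕ) :=
  (Fintype.piFinset fun i => Finset.range (y (β i) + 1)).filter fun c => blockSums β c = y

section
variable {ι κ : Type*} [DecidableEq ι]

lemma inv_factorial_smul_sum_pow {R : Type*} [CommRing R] [Algebra ℝ R] (s : Finset ι)
    (x : ι → R) (n : ℕ) :
    ((n.factorial : ℝ)⁻¹) • (∑ i ∈ s, x i) ^ n =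
      ∑ p ∈ s.piAntidiag n, ∏ i ∈ s, (((p i).factorial : ℝ)⁻¹) • x i ^ p i := by
  rw [Finset.sum_pow_eq_sum_piAntidiag, Finset.smul_sum]
  refine Finset.sum_congr rfl fun p hp => ?_
  rw [Finset.mem_piAntidiag] at hp
  have h := Nat.multinomial_spec s p
  rw [hp.1] at h
  have h' : (∏ i ∈ s, ((p i).factorial : ℝ)) * Nat.multinomial s p = n.factorial := by
    exact_mod_cast h
  have hne : (∏ i ∈ s, ((p i).factorial : ℝ)) ≠ 0 :=
    Finset.prod_ne_zero_iff.2 fun i _ => by positivity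
  rw [Finset.prod_smul, ← nsmul_eq_mul, ← Nat.cast_smul_eq_nsmul ℝ, smul_smul, ← h',
    Finset.prod_inv_distrib]
  congr 1
  have hm : (Nat.multinomial s p : ℝ) ≠ 0 := by
    intro h0
    rw [h0, mul_zero] at h'
    exact (by positivity : (n.factorial : ℝ) ≠ 0) h'.symm
  field_simp

variable [Fintype ι] [Fintype κ] [DecidableEq κ]

lemma mem_blockFiber (β : ι → κ) (y : κ → ℕ) (c : ι → ℕ) :
    c ∈ blockFiber β y ↔ blockSums β c = y := by
  rw [blockFiber, Finset.mem_filter, and_iff_right_iff_imp]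
  rintro rfl
  simp only [Fintype.mem_piFinset, Finset.mem_range, Nat.lt_succ_iff]
  exact fun i => Finset.single_le_sum (f := c) (fun _ _ => Nat.zero_le _) (by simp)

/-- The multinomial theorem, applied to every block. -/
lemma sum_blockFiber {R : Type*} [CommRing R] [Algebra ℝ R] (β : ι → κ) (y : κ → ℕ)
    (x : ι → R) :
    ∑ c ∈ blockFiber β y, ∏ i, (((c i).factorial : ℝ)⁻¹) • x i ^ c i =
      ∏ j, (((y j).factorial : ℝ)⁻¹) • (∑ i with β i = j, x i) ^ y j := by
  simp only [inv_factorial_smul_sum_pow]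
  rw [Finset.prod_univ_sum]
  symm
  refine Finset.sum_bij' (fun p _ i => p (β i) i) (fun c _ j i => if β i = j then c i else 0)
    ?_ ?_ ?_ ?_ ?_
  · intro p hp
    rw [mem_blockFiber]
    funext j
    have := Fintype.mem_piFinset.1 hp j
    rw [Finset.mem_piAntidiag] at this
    rw [blockSums, ← this.1]
    refine Finset.sum_congr rfl fun i hi => ?_
    rw [(Finset.mem_filter.1 hi).2]
  · intro c hc
    rw [mem_blockFiber] at hc
    refine Fintype.mem_piFinset.2 fun j => ?_
    rw [Finset.mem_piAntidiag]
    refine ⟨?_, fun i hi => ?_⟩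
    · rw [← hc, blockSums]
      refine Finset.sum_congr rfl fun i hi => ?_
      rw [if_pos (Finset.mem_filter.1 hi).2]
    · by_contra h
      exact hi (if_neg fun h' => h (by simp [h']))
  · intro p hp
    funext j i
    have := Fintype.mem_piFinset.1 hp j
    rw [Finset.mem_piAntidiag] at this
    by_cases h : β i = j
    · simp [h]
    · simp only [if_neg h]
      by_contra h0
      exact h (by simpa using this.2 i (Ne.symm h0))
  · intro c hc
    simp
  · intro p hp
    rw [← Finset.prod_fiberwise Finset.univ β]
    refine Finset.prod_congr rfl fun j _ => Finset.prod_congr rfl fun i hi => ?_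
    simp only [(Finset.mem_filter.1 hi).2]

end

lemma poissonPdf_nonneg {lam : ℝ} (h : 0 ≤ lam) (n : ℕ) : 0 ≤ poissonPdf lam n := by
  unfold poissonPdf
  positivity

lemma pmfVec_nonneg (k : ℕ) (c : Fin k → ℕ) : 0 ≤ pmfVec k c :=
  Finset.prod_nonneg fun _ _ => poissonPdf_nonneg (by positivity) _

/-- The expectation `E|𝓛(X_k)|`, with values in the extended non-negative reals. -/
def extendedEL (k : ℕ) : ENNReal :=
  ∑' c : Fin k → ℕ, ENNReal.ofReal (((Lset k c).card : ℝ) * pmfVec k c)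

lemma EL_eq_toReal (k : ℕ) : EL k = (extendedEL k).toReal := by
  rw [EL, extendedEL, ENNReal.tsum_toReal_eq fun _ => ENNReal.ofReal_ne_top]
  exact tsum_congr fun c =>
    (ENNReal.toReal_ofReal (mul_nonneg (Nat.cast_nonneg _) (pmfVec_nonneg k c))).symm

lemma tsum_ofReal_poissonPdf {lam : ℝ} (h : 0 ≤ lam) :
    ∑' x, ENNReal.ofReal (poissonPdf lam x) = 1 := by
  have hs : HasSum (poissonPdf lam) 1 := by
    have := (NormedSpace.expSeries_div_hasSum_exp lam).mul_left (Real.exp (-lam))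
    rw [← Real.exp_eq_exp_ℝ, ← Real.exp_add, neg_add_cancel, Real.exp_zero] at this
    unfold poissonPdf
    simpa only [mul_div_assoc] using this
  rw [← ENNReal.ofReal_tsum_of_nonneg (poissonPdf_nonneg h) hs.summable, hs.tsum_eq,
    ENNReal.ofReal_one]

lemma card_Lset_snoc (k : ℕ) (c : Fin k → ℕ) (x : ℕ) :
    (Lset k c).card ≤ (Lset (k + 1) (Fin.snoc c x : Fin (k + 1) → ℕ)).card := by
  refine Finset.card_le_card fun s hs => ?_
  obtain ⟨m, hm, rfl⟩ := Finset.mem_image.1 hs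
  refine Finset.mem_image.2 ⟨(Fin.snoc m 0 : Fin (k + 1) → ℕ), ?_, ?_⟩
  · rw [Finset.mem_Icc] at hm ⊢
    refine ⟨zero_le, fun i => ?_⟩
    refine Fin.lastCases ?_ (fun i => ?_) i
    · simp
    · simpa using hm.2 i
  · simp [Fin.sum_univ_castSucc]

lemma extendedEL_mono : Monotone extendedEL := by
  refine monotone_nat_of_le_succ fun k => ?_
  unfold extendedEL
  rw [← (Fin.snocEquiv fun _ : Fin (k + 1) => ℕ).tsum_eq, ENNReal.tsum_prod', ENNReal.tsum_comm]
  refine ENNReal.tsum_le_tsum fun c => ?_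
  have hlam : (0 : ℝ) ≤ 1 / ((k : ℕ) + 1) := by positivity
  calc _ = ∑' x, ENNReal.ofReal (((Lset k c).card : ℝ) * pmfVec k c) *
        ENNReal.ofReal (poissonPdf (1 / ((k : ℕ) + 1)) x) := by
        rw [ENNReal.tsum_mul_left, tsum_ofReal_poissonPdf hlam, mul_one]
    _ ≤ _ := by
        refine ENNReal.tsum_le_tsum fun x => ?_
        rw [← ENNReal.ofReal_mul (mul_nonneg (Nat.cast_nonneg _) (pmfVec_nonneg k c))]
        apply ENNReal.ofReal_le_ofReal
        have hp : pmfVec (k + 1) (Fin.snoc c x : Fin (k + 1) → ℕ) =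
            pmfVec k c * poissonPdf (1 / ((k : ℕ) + 1)) x := by
          simp [pmfVec, Fin.prod_univ_castSucc]
        change _ ≤ ((Lset (k + 1) (Fin.snoc c x : Fin (k + 1) → ℕ)).card : ℝ) *
          pmfVec (k + 1) (Fin.snoc c x : Fin (k + 1) → ℕ)
        rw [hp, mul_assoc]
        exact mul_le_mul_of_nonneg_right (Nat.cast_le.2 (card_Lset_snoc k c x))
          (mul_nonneg (pmfVec_nonneg k c) (poissonPdf_nonneg hlam x))

lemma tsum_eq_tsum_blockFiber {ι κ : Type*} [Fintype ι] [DecidableEq ι] [Fintype κ]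
    [DecidableEq κ] (β : ι → κ) (f : (ι → ℕ) → ENNReal) :
    ∑' c, f c = ∑' y, ∑ c ∈ blockFiber β y, f c := by
  have h1 : ∀ c, f c = ∑' y, if blockSums β c = y then f c else 0 := fun c => by
    rw [tsum_ite_eq']
  rw [tsum_congr h1, ENNReal.tsum_comm]
  refine tsum_congr fun y => ?_
  rw [tsum_eq_sum (s := blockFiber β y)]
  · exact Finset.sum_congr rfl fun c hc => if_pos ((mem_blockFiber β y c).1 hc)
  · exact fun c hc => if_neg fun h => hc ((mem_blockFiber β y c).2 h)

lemma pmfVec_eq (k : ℕ) (c : Fin k → ℕ) :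
    pmfVec k c = Real.exp (-(harmonic k : ℝ)) *
      ∏ i : Fin k, (((c i).factorial : ℝ)⁻¹ * (1 / (((i : ℕ) : ℝ) + 1)) ^ c i) := by
  have h : -(harmonic k : ℝ) = ∑ i : Fin k, -(1 / (((i : ℕ) : ℝ) + 1)) := by
    rw [Finset.sum_neg_distrib, Fin.sum_univ_eq_sum_range (fun i => 1 / ((i : ℝ) + 1))]
    simp [harmonic]
  rw [h, Real.exp_sum, ← Finset.prod_mul_distrib]
  refine Finset.prod_congr rfl fun i _ => ?_
  rw [poissonPdf]
  ring

lemma exp_neg_harmonic_le (k : ℕ) : Real.exp (-(harmonic k : ℝ)) ≤ 1 / ((k : ℝ) + 1) := by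
  have h := log_add_one_le_harmonic k
  push_cast at h
  calc _ ≤ Real.exp (-Real.log ((k : ℝ) + 1)) := Real.exp_le_exp.2 (neg_le_neg h)
    _ = _ := by rw [Real.exp_neg, Real.exp_log (by positivity), one_div]

lemma le_exp_neg_harmonic (k : ℕ) :
    1 / (Real.exp 1 * ((k : ℝ) + 1)) ≤ Real.exp (-(harmonic k : ℝ)) := by
  have h := harmonic_le_one_add_log k
  have h' : Real.log k ≤ Real.log ((k : ℝ) + 1) := by
    rcases Nat.eq_zero_or_pos k with rfl | hk
    · simp
    · exact Real.log_le_log (by exact_mod_cast hk) (by linarith)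
  calc 1 / (Real.exp 1 * ((k : ℝ) + 1)) = Real.exp (-(1 + Real.log ((k : ℝ) + 1))) := by
        rw [Real.exp_neg, Real.exp_add, Real.exp_log (by positivity), one_div]
    _ ≤ _ := Real.exp_le_exp.2 (by linarith)

lemma card_Lset_le (k : ℕ) (c : Fin k → ℕ) (p : Fin k → Prop) [DecidablePred p] :
    (Lset k c).card ≤ 2 ^ (∑ i, if p i then c i else 0) *
      (1 + ∑ i : Fin k, if p i then 0 else ((i : ℕ) + 1) * c i) := by
  let S := (Finset.Icc 0 fun i => if p i then c i else 0) ×ˢ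
    Finset.range (1 + ∑ i : Fin k, if p i then 0 else ((i : ℕ) + 1) * c i)
  have hsub : Lset k c ⊆ S.image fun q => (∑ i : Fin k, ((i : ℕ) + 1) * q.1 i) + q.2 := by
    intro s hs
    obtain ⟨m, hm, rfl⟩ := Finset.mem_image.1 hs
    have hm' : ∀ i, m i ≤ c i := (Finset.mem_Icc.1 hm).2
    refine Finset.mem_image.2 ⟨(fun i => if p i then m i else 0,
      ∑ i : Fin k, if p i then 0 else ((i : ℕ) + 1) * m i), ?_, ?_⟩
    · refine Finset.mem_product.2 ⟨Finset.mem_Icc.2 ⟨zero_le, fun i => ?_⟩,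
        Finset.mem_range.2 ?_⟩
      · dsimp only
        split_ifs
        · exact hm' i
        · exact le_rfl
      · dsimp only
        refine lt_of_le_of_lt (Finset.sum_le_sum fun i _ => ?_) (lt_one_add _)
        split_ifs
        · exact le_rfl
        · exact Nat.mul_le_mul_left _ (hm' i)
    · dsimp only
      rw [← Finset.sum_add_distrib]
      exact Finset.sum_congr rfl fun i _ => by split_ifs <;> simp
  calc _ ≤ S.card := (Finset.card_le_card hsub).trans Finset.card_image_le
    _ ≤ _ := by
        rw [Finset.card_product, Finset.card_range, Pi.card_Icc, ← Finset.prod_pow_eq_pow_sum]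
        refine Nat.mul_le_mul_right _ (Finset.prod_le_prod' fun i _ => ?_)
        rw [Nat.card_Icc]
        exact Nat.lt_two_pow_self

lemma sum_blockSums {ι κ : Type*} [Fintype ι] [Fintype κ] [DecidableEq κ] (β : ι → κ)
    (c : ι → ℕ) (f : κ → ℕ) :
    ∑ j, f j * blockSums β c j = ∑ i, f (β i) * c i := by
  rw [← Finset.sum_fiberwise Finset.univ β]
  refine Finset.sum_congr rfl fun j _ => ?_
  rw [blockSums, Finset.mul_sum]
  refine Finset.sum_congr rfl fun i hi => ?_
  rw [(Finset.mem_filter.1 hi).2]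

lemma sum_blockFiber_le {κ : Type*} [Fintype κ] [DecidableEq κ] (k : ℕ) (β : Fin k → κ)
    (y : κ → ℕ) (b : ℝ) (hb : ∀ c, blockSums β c = y → ((Lset k c).card : ℝ) ≤ b) :
    ∑ c ∈ blockFiber β y, ENNReal.ofReal (((Lset k c).card : ℝ) * pmfVec k c) ≤
      ENNReal.ofReal (Real.exp (-(harmonic k : ℝ)) * b *
        ∏ j, (((y j).factorial : ℝ)⁻¹ *
          (∑ i : Fin k with β i = j, 1 / (((i : ℕ) : ℝ) + 1)) ^ y j)) := by
  rw [← ENNReal.ofReal_sum_of_nonneg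
    fun c _ => mul_nonneg (Nat.cast_nonneg _) (pmfVec_nonneg k c)]
  apply ENNReal.ofReal_le_ofReal
  have h := sum_blockFiber β y fun i : Fin k => 1 / (((i : ℕ) : ℝ) + 1)
  simp only [smul_eq_mul] at h
  rw [← h, Finset.mul_sum]
  refine Finset.sum_le_sum fun c hc => ?_
  calc _ ≤ b * pmfVec k c :=
        mul_le_mul_of_nonneg_right (hb c ((mem_blockFiber β y c).1 hc)) (pmfVec_nonneg k c)
    _ = _ := by rw [pmfVec_eq]; ring

/-- The index of the dyadic block containing `i + 1`; the first block is `{1}`, and the others are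
the intervals `(2 ^ j, 2 ^ (j + 1)]`. -/
def upperBlock (n : ℕ) (i : Fin (2 ^ n)) : Fin (n + 1) :=
  ⟨Nat.clog 2 (i + 1), Nat.lt_succ_of_le
    ((Nat.clog_le_iff_le_pow (by norm_num)).2 i.isLt)⟩

lemma dyadic_sum_bounds (a : ℕ) :
    ∑ i ∈ Finset.Ico ((2 : ℕ) ^ a) (2 ^ (a + 1)), 1 / ((i : ℝ) + 1) ≤ Real.log 2 ∧
    Real.log 2 ≤ ∑ i ∈ Finset.Ico ((2 : ℕ) ^ a) (2 ^ (a + 1)), 1 / (i : ℝ) := by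
  have hstep : ∀ i : ℕ, 0 < i → 1 / ((i : ℝ) + 1) ≤ Real.log ((i + 1 : ℕ) : ℝ) - Real.log i ∧
      Real.log ((i + 1 : ℕ) : ℝ) - Real.log i ≤ 1 / (i : ℝ) := by
    intro i hi
    have hi' : (0 : ℝ) < i := by exact_mod_cast hi
    rw [← Real.log_div (by positivity) (by positivity)]
    push_cast
    constructor
    · have := Real.one_sub_inv_le_log_of_pos (show (0 : ℝ) < (i + 1) / i by positivity)
      refine le_trans (le_of_eq ?_) this
      field_simp
      ring
    · have := Real.log_le_sub_one_of_pos (show (0 : ℝ) < (i + 1) / i by positivity)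
      refine this.trans (le_of_eq ?_)
      field_simp
      ring
  have htel : ∑ i ∈ Finset.Ico (2 ^ a) (2 ^ (a + 1)), (Real.log ((i + 1 : ℕ) : ℝ) - Real.log i) =
      Real.log 2 := by
    rw [Finset.sum_Ico_sub (fun i : ℕ => Real.log (i : ℝ))
      (Nat.pow_le_pow_right (by norm_num) (Nat.le_succ a))]
    push_cast
    rw [Real.log_pow, Real.log_pow]
    push_cast
    ring
  have hpos : ∀ i ∈ Finset.Ico (2 ^ a) (2 ^ (a + 1)), 0 < i := fun i hi =>
    lt_of_lt_of_le (by positivity) (Finset.mem_Ico.1 hi).1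
  exact ⟨htel ▸ Finset.sum_le_sum fun i hi => (hstep i (hpos i hi)).1,
    htel ▸ Finset.sum_le_sum fun i hi => (hstep i (hpos i hi)).2⟩

lemma sum_upperBlock_zero (n : ℕ) :
    ∑ i : Fin (2 ^ n) with upperBlock n i = 0, 1 / (((i : ℕ) : ℝ) + 1) ≤ 1 := by
  have : ∀ i : Fin (2 ^ n), upperBlock n i = 0 → i = ⟨0, by positivity⟩ := by
    intro i hi
    have h0 : Nat.clog 2 (i + 1) = 0 := congrArg Fin.val hi
    have := (Nat.clog_le_iff_le_pow (by norm_num : 1 < 2)).1 h0.le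
    ext
    simp at this
    simpa using this
  calc _ ≤ ∑ i ∈ {(⟨0, by positivity⟩ : Fin (2 ^ n))}, 1 / (((i : ℕ) : ℝ) + 1) := by
        refine Finset.sum_le_sum_of_subset_of_nonneg (fun i hi => ?_) fun i _ _ => by positivity
        rw [Finset.mem_singleton]
        exact this i (Finset.mem_filter.1 hi).2
    _ = 1 := by simp

lemma sum_upperBlock_succ (n : ℕ) (j : Fin n) :
    ∑ i : Fin (2 ^ n) with upperBlock n i = j.succ, 1 / (((i : ℕ) : ℝ) + 1) ≤ Real.log 2 := by
  refine le_trans ?_ (dyadic_sum_bounds j).1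
  rw [← Finset.sum_image (s := Finset.univ.filter fun i => upperBlock n i = j.succ)
    (g := fun i : Fin (2 ^ n) => (i : ℕ)) (f := fun i : ℕ => 1 / ((i : ℝ) + 1))
    fun _ _ _ _ h => Fin.ext h]
  refine Finset.sum_le_sum_of_subset_of_nonneg (fun i hi => ?_) fun i _ _ => by positivity
  obtain ⟨i, hi', rfl⟩ := Finset.mem_image.1 hi
  have h : Nat.clog 2 ((i : ℕ) + 1) = j + 1 := by
    have hj : upperBlock n i = j.succ := (Finset.mem_filter.1 hi').2
    exact congrArg Fin.val hj
  have h1 := (Nat.clog_le_iff_le_pow (by norm_num : 1 < 2)).1 h.le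
  have h2 := (Nat.lt_clog_iff_pow_lt (by norm_num : 1 < 2)).1 (show (j : ℕ) < _ by rw [h]; omega)
  rw [Finset.mem_Ico]
  omega

lemma card_Lset_le_upperBlock (n : ℕ) (c : Fin (2 ^ n) → ℕ) (j : ℕ) :
    (Lset (2 ^ n) c).card ≤ 2 ^ blockSums (upperBlock n) c 0 *
      (2 ^ (∑ i : Fin n, if (i : ℕ) < j then 0 else blockSums (upperBlock n) c i.succ) *
        (1 + ∑ i : Fin n, if (i : ℕ) < j then
          2 ^ ((i : ℕ) + 1) * blockSums (upperBlock n) c i.succ else 0)) := by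
  let p : Fin (n + 1) → Prop := fun b => b = 0 ∨ j < b
  have h := card_Lset_le (2 ^ n) c fun i => p (upperBlock n i)
  have h1 := sum_blockSums (upperBlock n) c fun b => if p b then 1 else 0
  have h2 := sum_blockSums (upperBlock n) c fun b => if p b then 0 else 2 ^ (b : ℕ)
  simp only [ite_mul, one_mul, zero_mul] at h1 h2
  rw [← h1] at h
  rw [← mul_assoc, ← pow_add]
  refine h.trans (Nat.mul_le_mul (Nat.pow_le_pow_right (by norm_num) (le_of_eq ?_)) ?_)
  · rw [Fin.sum_univ_succ, if_pos (Or.inl rfl)]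
    congr 1
    refine Finset.sum_congr rfl fun i _ => ?_
    have : p i.succ ↔ ¬ (i : ℕ) < j := by
      simp only [p, Fin.succ_ne_zero, false_or, Fin.val_succ]
      omega
    simp only [this, ite_not]
  · refine Nat.add_le_add_left ?_ 1
    calc _ ≤ ∑ i, if p (upperBlock n i) then 0 else 2 ^ (upperBlock n i : ℕ) * c i := by
          refine Finset.sum_le_sum fun i _ => ?_
          split_ifs
          · exact le_rfl
          · exact Nat.mul_le_mul_right _ (Nat.le_pow_clog (by norm_num) _)
      _ = _ := by
          rw [← h2, Fin.sum_univ_succ, if_pos (Or.inl rfl), zero_add]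
          refine Finset.sum_congr rfl fun i _ => ?_
          have : p i.succ ↔ ¬ (i : ℕ) < j := by
            simp only [p, Fin.succ_ne_zero, false_or, Fin.val_succ]
            omega
          simp only [this, ite_not, Fin.val_succ]

lemma sum_blockFiber_upperBlock_le (n y0 : ℕ) (y : Fin n → ℕ) (b : ℝ) (hb0 : 0 ≤ b)
    (hb : ∀ c, blockSums (upperBlock n) c = Fin.cons y0 y →
      ((Lset (2 ^ n) c).card : ℝ) ≤ 2 ^ y0 * b) :
    ∑ c ∈ blockFiber (upperBlock n) (Fin.cons y0 y : Fin (n + 1) → ℕ),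
      ENNReal.ofReal (((Lset (2 ^ n) c).card : ℝ) * pmfVec (2 ^ n) c) ≤
    ENNReal.ofReal ((2 ^ n)⁻¹ * ((y0.factorial : ℝ)⁻¹ * 2 ^ y0)) *
      (ENNReal.ofReal (Real.log 2 ^ (∑ i, y i) * b) * invFactorials y) := by
  have hlog : 0 < Real.log 2 := Real.log_pos (by norm_num)
  have hinv : invFactorials y = ENNReal.ofReal (∏ i, ((y i).factorial : ℝ)⁻¹) := by
    rw [invFactorials, ENNReal.ofReal_prod_of_nonneg fun i _ => by positivity]
    exact Finset.prod_congr rfl fun i _ => (ofReal_inv_factorial _).symm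
  refine (sum_blockFiber_le _ _ _ _ hb).trans ?_
  rw [hinv, ← ENNReal.ofReal_mul (by positivity), ← ENNReal.ofReal_mul (by positivity)]
  apply ENNReal.ofReal_le_ofReal
  have he : Real.exp (-(harmonic (2 ^ n) : ℝ)) ≤ (2 ^ n)⁻¹ := by
    refine (exp_neg_harmonic_le _).trans ?_
    rw [one_div]
    push_cast
    gcongr
    linarith
  have hprod : ∏ j, ((((Fin.cons y0 y : Fin (n + 1) → ℕ) j).factorial : ℝ)⁻¹ *
      (∑ i : Fin (2 ^ n) with upperBlock n i = j, 1 / (((i : ℕ) : ℝ) + 1)) ^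
        (Fin.cons y0 y : Fin (n + 1) → ℕ) j) ≤
      (y0.factorial : ℝ)⁻¹ * ∏ i, (((y i).factorial : ℝ)⁻¹ * Real.log 2 ^ y i) := by
    have hnn : ∀ j, 0 ≤ ∑ i : Fin (2 ^ n) with upperBlock n i = j, 1 / (((i : ℕ) : ℝ) + 1) :=
      fun j => Finset.sum_nonneg fun i _ => by positivity
    rw [Fin.prod_univ_succ]
    simp only [Fin.cons_zero, Fin.cons_succ]
    refine mul_le_mul (mul_le_of_le_one_right (by positivity)
      (pow_le_one₀ (hnn 0) (sum_upperBlock_zero n)))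
      (Finset.prod_le_prod (fun i _ => mul_nonneg (by positivity) (pow_nonneg (hnn _) _))
        fun i _ => mul_le_mul_of_nonneg_left
          (pow_le_pow_left₀ (hnn _) (sum_upperBlock_succ n i) _) (by positivity))
      (Finset.prod_nonneg fun i _ => mul_nonneg (by positivity) (pow_nonneg (hnn _) _))
      (by positivity)
  have hdist : ∏ i, (((y i).factorial : ℝ)⁻¹ * Real.log 2 ^ y i) =
      (∏ i, ((y i).factorial : ℝ)⁻¹) * Real.log 2 ^ (∑ i, y i) := by
    rw [Finset.prod_mul_distrib, Finset.prod_pow_eq_pow_sum]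
  rw [hdist] at hprod
  calc _ ≤ (2 ^ n)⁻¹ * (2 ^ y0 * b) * ((y0.factorial : ℝ)⁻¹ *
        ((∏ i, ((y i).factorial : ℝ)⁻¹) * Real.log 2 ^ (∑ i, y i))) :=
        mul_le_mul (mul_le_mul_of_nonneg_right he (by positivity)) hprod
          (Finset.prod_nonneg fun j _ => mul_nonneg (by positivity)
            (pow_nonneg (Finset.sum_nonneg fun i _ => by positivity) _)) (by positivity)
    _ = _ := by ring

lemma extendedEL_two_pow_le :
    ∃ C : ℝ, 0 < C ∧ ∀ n : ℕ, extendedEL (2 ^ n) ≤ ENNReal.ofReal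
      (C * ((Real.exp 1 * Real.log 2) ^ n * ((n : ℝ) + 1) ^ (-(3 / 2) : ℝ))) := by
  obtain ⟨C, hC, hF⟩ := tsum_path_upper
  have hlog : 0 < Real.log 2 := Real.log_pos (by norm_num)
  refine ⟨Real.exp 2 * C, by positivity, fun n => ?_⟩
  let bd : ℕ → (Fin n → ℕ) → ℝ := fun j y =>
    2 ^ (∑ i : Fin n, if (i : ℕ) < j then 0 else y i) *
      (1 + ∑ i : Fin n, if (i : ℕ) < j then 2 ^ ((i : ℕ) + 1) * (y i : ℝ) else 0)
  have hbd0 : ∀ j y, 0 ≤ bd j y := fun j y =>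
    mul_nonneg (by positivity) (add_nonneg zero_le_one
      (Finset.sum_nonneg fun i _ => by split_ifs <;> positivity))
  have hne : (Finset.range (n + 1)).Nonempty := ⟨0, Finset.mem_range.2 (by omega)⟩
  let B : (Fin n → ℕ) → ℝ := fun y => (Finset.range (n + 1)).inf' hne fun j => bd j y
  have hB0 : ∀ y, 0 ≤ B y := fun y => Finset.le_inf' _ _ fun j _ => hbd0 j y
  have hB := hF n B fun y j hj =>
    Finset.inf'_le (fun j => bd j y) (Finset.mem_range.2 (Nat.lt_succ_of_le hj))
  have hcard : ∀ c : Fin (2 ^ n) → ℕ, ((Lset (2 ^ n) c).card : ℝ) ≤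
      2 ^ blockSums (upperBlock n) c 0 * B (Fin.tail (blockSums (upperBlock n) c)) := by
    intro c
    have hp : (0 : ℝ) < 2 ^ blockSums (upperBlock n) c 0 := by positivity
    rw [← div_le_iff₀' hp]
    refine Finset.le_inf' _ _ fun j _ => ?_
    rw [div_le_iff₀' hp]
    simp only [bd, Fin.tail]
    exact_mod_cast card_Lset_le_upperBlock n c j
  have hexp : ∑' y0 : ℕ, ENNReal.ofReal ((2 ^ n)⁻¹ * ((y0.factorial : ℝ)⁻¹ * 2 ^ y0)) =
      ENNReal.ofReal ((2 ^ n)⁻¹ * Real.exp 2) := by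
    have hs : HasSum (fun y0 : ℕ => (2 ^ n : ℝ)⁻¹ * ((y0.factorial : ℝ)⁻¹ * 2 ^ y0))
        ((2 ^ n)⁻¹ * Real.exp 2) := by
      have := (NormedSpace.expSeries_div_hasSum_exp (2 : ℝ)).mul_left ((2 ^ n : ℝ)⁻¹)
      rw [← Real.exp_eq_exp_ℝ] at this
      simpa only [div_eq_inv_mul] using this
    rw [← ENNReal.ofReal_tsum_of_nonneg (fun _ => by positivity) hs.summable, hs.tsum_eq]
  rw [extendedEL, tsum_eq_tsum_blockFiber (upperBlock n), tsum_fin_succ]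
  calc _ ≤ ∑' y0 : ℕ, ∑' y : Fin n → ℕ,
        ENNReal.ofReal ((2 ^ n)⁻¹ * ((y0.factorial : ℝ)⁻¹ * 2 ^ y0)) *
        (ENNReal.ofReal (Real.log 2 ^ (∑ i, y i) * B y) * invFactorials y) :=
        ENNReal.tsum_le_tsum fun y0 => ENNReal.tsum_le_tsum fun y =>
          sum_blockFiber_upperBlock_le n y0 y (B y) (hB0 y) fun c hc => by
            simpa only [hc, Fin.cons_zero, Fin.tail_cons] using hcard c
    _ ≤ ENNReal.ofReal ((2 ^ n)⁻¹ * Real.exp 2) * ENNReal.ofReal (C * ((2 * Real.log 2) ^ n *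
          (Real.exp n * ((n : ℝ) + 1) ^ (-(3 / 2) : ℝ)))) := by
        simp only [ENNReal.tsum_mul_left]
        rw [ENNReal.tsum_mul_right, hexp]
        gcongr
    _ = _ := by
        rw [← ENNReal.ofReal_mul (by positivity)]
        congr 1
        have : Real.exp n = Real.exp 1 ^ n := by rw [← Real.exp_nat_mul, mul_one]
        rw [this, mul_pow, mul_pow]
        field_simp

section LaurentBounds
open LaurentPolynomial

/-- The constant coefficient of a Laurent polynomial, as a linear functional. -/
def constCoeff : LaurentPolynomial ℝ →ₗ[ℝ] ℝ where
  toFun f := f.coeff 0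
  map_add' _ _ := rfl
  map_smul' _ _ := rfl

/-- Evaluation of a Laurent polynomial at `1`. -/
def evalOne : LaurentPolynomial ℝ →+* ℝ := eval₂ (RingHom.id ℝ) 1

lemma evalOne_T (a : ℤ) : evalOne (T a) = 1 := by simp [evalOne]

lemma evalOne_C (r : ℝ) : evalOne (C r) = r := by simp [evalOne]

lemma evalOne_smul (r : ℝ) (f : LaurentPolynomial ℝ) : evalOne (r • f) = r * evalOne f := by
  rw [smul_eq_C_mul, map_mul, evalOne_C]

lemma constCoeff_T (a : ℤ) : constCoeff (T a) = if a = 0 then 1 else 0 :=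
  T_apply 0 a

lemma coeff_mul_eq_sum (f P : LaurentPolynomial ℝ) (b : ℤ) :
    (f * P).coeff b = ∑ a ∈ f.coeff.support, f.coeff a * P.coeff (b - a) := by
  conv_lhs => rw [← AddMonoidAlgebra.sum_coeff_single f]
  rw [Finsupp.sum, Finset.sum_mul, AddMonoidAlgebra.coeff_sum, Finsupp.finsetSum_apply]
  refine Finset.sum_congr rfl fun a _ => ?_
  rw [AddMonoidAlgebra.coeff_single_mul_apply, neg_add_eq_sub]

lemma evalOne_eq_sum (f : LaurentPolynomial ℝ) :
    evalOne f = ∑ a ∈ f.coeff.support, f.coeff a := by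
  conv_lhs => rw [← AddMonoidAlgebra.sum_coeff_single f]
  rw [Finsupp.sum, map_sum]
  refine Finset.sum_congr rfl fun a _ => ?_
  rw [single_eq_C_mul_T, map_mul, evalOne_C, evalOne_T, mul_one]

lemma coeff_mul_nonneg {f P : LaurentPolynomial ℝ} (hf : ∀ a, 0 ≤ f.coeff a)
    (hP : ∀ a, 0 ≤ P.coeff a) (b : ℤ) : 0 ≤ (f * P).coeff b := by
  rw [coeff_mul_eq_sum]
  exact Finset.sum_nonneg fun a _ => mul_nonneg (hf a) (hP _)

lemma constCoeff_mul_le {f P : LaurentPolynomial ℝ} (hf : ∀ a, 0 ≤ f.coeff a) {M : ℝ}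
    (hP : ∀ a, P.coeff a ≤ M) : constCoeff (f * P) ≤ M * evalOne f := by
  change (f * P).coeff 0 ≤ _
  rw [coeff_mul_eq_sum, evalOne_eq_sum, Finset.mul_sum]
  refine Finset.sum_le_sum fun a _ => ?_
  rw [mul_comm]
  exact mul_le_mul_of_nonneg_right (hP _) (hf a)

/-- If a Laurent polynomial is a combination of monomials with exponents in `S`, then `S` is large
as soon as the sum of the squares of the coefficients is small. -/
lemma le_card_of_eq_sum {S : Finset ℕ} {a : ℕ → ℝ} {r : LaurentPolynomial ℝ}
    (hr : r = ∑ s ∈ S, a s • T (s : ℤ)) {τ : ℝ} (hτ : 0 < τ) :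
    2 * evalOne r / τ - constCoeff (r * invert r) / τ ^ 2 ≤ S.card := by
  have h1 : evalOne r = ∑ s ∈ S, a s := by
    rw [hr, map_sum]
    exact Finset.sum_congr rfl fun s _ => by rw [evalOne_smul, evalOne_T, mul_one]
  have h2 : constCoeff (r * invert r) = ∑ s ∈ S, a s ^ 2 := by
    have hinv : invert r = ∑ s ∈ S, a s • T (-(s : ℤ)) := by
      rw [hr, map_sum]
      exact Finset.sum_congr rfl fun s _ => by rw [map_smul, invert_T]
    rw [hinv, hr, Finset.sum_mul_sum, map_sum]
    refine Finset.sum_congr rfl fun s hs => ?_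
    have : ∀ s', constCoeff ((a s • T (s : ℤ)) * (a s' • T (-(s' : ℤ)))) =
        if s = s' then a s * a s' else 0 := by
      intro s'
      rw [smul_mul_smul_comm, ← T_add, map_smul, constCoeff_T, smul_eq_mul, mul_ite, mul_one,
        mul_zero]
      exact if_congr (by omega) rfl rfl
    rw [map_sum]
    simp only [this]
    rw [Finset.sum_ite_eq, if_pos hs, sq]
  rw [h1, h2, Finset.mul_sum, Finset.sum_div, Finset.sum_div, ← Finset.sum_sub_distrib,
    Finset.card_eq_sum_ones, Nat.cast_sum]
  refine Finset.sum_le_sum fun s _ => ?_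
  have h : (0 : ℝ) ≤ (a s / τ - 1) ^ 2 := sq_nonneg _
  have e : (a s / τ - 1) ^ 2 = a s ^ 2 / τ ^ 2 - 2 * a s / τ + 1 := by
    field_simp
    ring
  push_cast
  linarith

/-- The factor of the correlation polynomial that comes from the part `i`. -/
def correlationFactor (i : ℕ) : LaurentPolynomial ℝ := 2 + (T (i : ℤ) + T (-(i : ℤ)))

lemma le_card_Lset (k : ℕ) (c : Fin k → ℕ) {τ : ℝ} (hτ : 0 < τ) :
    2 * 2 ^ (∑ i, c i) / τ -
      constCoeff (∏ i : Fin k, correlationFactor ((i : ℕ) + 1) ^ c i) / τ ^ 2 ≤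
      (Lset k c).card := by
  let wt : (Fin k → ℕ) → ℕ := fun m => ∑ i : Fin k, ((i : ℕ) + 1) * m i
  let r : LaurentPolynomial ℝ := ∏ i : Fin k, (T (((i : ℕ) + 1 : ℕ) : ℤ) + 1) ^ c i
  have hr : r = ∑ s ∈ Lset k c, (∑ m ∈ Finset.Icc 0 c with wt m = s,
      ∏ i, ((c i).choose (m i) : ℝ)) • T (s : ℤ) := by
    have hpi : Finset.Icc 0 c = Fintype.piFinset fun i => Finset.range (c i + 1) := by
      ext m
      simp [Pi.le_def]
    have hexp : r = ∑ m ∈ Finset.Icc 0 c, (∏ i, ((c i).choose (m i) : ℝ)) • T (wt m : ℤ) := by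
      simp only [r, add_pow, one_pow, mul_one]
      rw [Finset.prod_univ_sum, hpi]
      refine Finset.sum_congr rfl fun m _ => ?_
      have hT : (T (wt m : ℤ) : LaurentPolynomial ℝ) =
          ∏ i : Fin k, T (((i : ℕ) + 1 : ℕ) : ℤ) ^ m i := by
        simp only [wt, Nat.cast_sum, T_pow]
        induction (Finset.univ : Finset (Fin k)) using Finset.induction_on with
        | empty => simp
        | insert i s hi ih =>
          rw [Finset.sum_insert hi, Finset.prod_insert hi, T_add, ih]
          push_cast
          rw [mul_comm (m i : ℤ)]
      rw [hT, Finset.prod_mul_distrib, smul_eq_C_mul, map_prod, mul_comm]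
      simp
    rw [hexp, Lset, ← Finset.sum_fiberwise_of_maps_to (g := wt)
      (t := (Finset.Icc 0 c).image wt) fun m hm => Finset.mem_image_of_mem _ hm]
    refine Finset.sum_congr rfl fun s _ => ?_
    rw [Finset.sum_smul]
    refine Finset.sum_congr rfl fun m hm => ?_
    rw [(Finset.mem_filter.1 hm).2]
  have h := le_card_of_eq_sum hr hτ
  have h1 : evalOne r = 2 ^ (∑ i, c i) := by
    simp only [r, map_prod, map_pow, map_add, evalOne_T, map_one]
    rw [Finset.prod_pow_eq_pow_sum]
    norm_num
  have h2 : r * invert r = ∏ i : Fin k, correlationFactor ((i : ℕ) + 1) ^ c i := by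
    simp only [r, map_prod, map_pow, map_add, invert_T, map_one]
    rw [← Finset.prod_mul_distrib]
    refine Finset.prod_congr rfl fun i _ => ?_
    rw [← mul_pow, correlationFactor]
    congr 1
    have : (T (((i : ℕ) + 1 : ℕ) : ℤ) : LaurentPolynomial ℝ) * T (-(((i : ℕ) + 1 : ℕ) : ℤ)) = 1 := by
      rw [← T_add, add_neg_cancel, T_zero]
    linear_combination this
  rwa [h1, h2] at h

lemma constCoeff_mul_pow_le {l : ℝ} (hl : 1 ≤ 2 * l) {M : ℝ} (hM : 0 ≤ M)
    {P : LaurentPolynomial ℝ} (hP0 : ∀ a, 0 ≤ P.coeff a) (hPM : ∀ a, P.coeff a ≤ M)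
    (hP1 : evalOne P = 2 * l) (y : ℕ) (f : LaurentPolynomial ℝ) (hf : ∀ a, 0 ≤ f.coeff a) :
    constCoeff (f * (C (2 * l) + P) ^ y) ≤
      (2 * l) ^ y * (constCoeff f + M * 2 ^ y * evalOne f) ∧
    (∀ a, 0 ≤ (f * (C (2 * l) + P) ^ y).coeff a) ∧
    evalOne (f * (C (2 * l) + P) ^ y) = evalOne f * (4 * l) ^ y := by
  have hl0 : 0 < 2 * l := by linarith
  have hE : ∀ g : LaurentPolynomial ℝ, (∀ a, 0 ≤ g.coeff a) → 0 ≤ evalOne g := fun g hg => by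
    rw [evalOne_eq_sum]
    exact Finset.sum_nonneg fun a _ => hg a
  suffices h : constCoeff (f * (C (2 * l) + P) ^ y) ≤
      (2 * l) ^ y * (constCoeff f + M * (2 ^ y - 1) * evalOne f) ∧
    (∀ a, 0 ≤ (f * (C (2 * l) + P) ^ y).coeff a) ∧
    evalOne (f * (C (2 * l) + P) ^ y) = evalOne f * (4 * l) ^ y by
    refine ⟨h.1.trans ?_, h.2⟩
    have := hE f hf
    gcongr
    linarith
  induction y generalizing f with
  | zero => simpa using hf
  | succ y ih =>
    have hC : ∀ a, 0 ≤ (C (2 * l) + P).coeff a := fun a => by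
      rw [AddMonoidAlgebra.coeff_add, Finsupp.add_apply, C_apply]
      have := hP0 a
      split_ifs <;> linarith
    have hg := coeff_mul_nonneg hf hC
    have hg1 : evalOne (f * (C (2 * l) + P)) = evalOne f * (4 * l) := by
      rw [map_mul, map_add, evalOne_C, hP1]
      ring
    have hg2 : constCoeff (f * (C (2 * l) + P)) ≤ 2 * l * constCoeff f + M * evalOne f := by
      rw [mul_add, map_add, mul_comm f (C _), ← smul_eq_C_mul, map_smul, smul_eq_mul]
      exact add_le_add le_rfl (constCoeff_mul_le hf hPM)
    obtain ⟨i1, i2, i3⟩ := ih _ hg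
    rw [mul_assoc, ← pow_succ'] at i1 i2 i3
    refine ⟨i1.trans ?_, i2, by rw [i3, hg1]; ring⟩
    have hme := mul_nonneg hM (hE f hf)
    rw [hg1, pow_succ (2 * l), mul_assoc ((2 * l) ^ y)]
    refine mul_le_mul_of_nonneg_left ?_ (by positivity)
    have : M * evalOne f ≤ 2 * l * (M * evalOne f) := le_mul_of_one_le_left hme hl
    rw [pow_succ]
    linarith

lemma constCoeff_prod_le {l : ℝ} (hl : 1 ≤ 2 * l) (n : ℕ) (P : Fin n → LaurentPolynomial ℝ)
    (M : Fin n → ℝ) (hM : ∀ j, 0 ≤ M j) (hP0 : ∀ j a, 0 ≤ (P j).coeff a)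
    (hPM : ∀ j a, (P j).coeff a ≤ M j) (hP1 : ∀ j, evalOne (P j) = 2 * l) (y : Fin n → ℕ) :
    constCoeff (∏ j, (C (2 * l) + P j) ^ y j) ≤
      (2 * l) ^ (∑ j, y j) * (1 + ∑ j, M j * 2 ^ (∑ i, if i ≤ j then y i else 0)) ∧
    (∀ a, 0 ≤ (∏ j, (C (2 * l) + P j) ^ y j).coeff a) ∧
    evalOne (∏ j, (C (2 * l) + P j) ^ y j) = (4 * l) ^ (∑ j, y j) := by
  induction n with
  | zero =>
    refine ⟨?_, fun a => ?_, ?_⟩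
    · have h1 : constCoeff 1 = 1 := by rw [← T_zero, constCoeff_T, if_pos rfl]
      simp [h1]
    · rw [Finset.univ_eq_empty, Finset.prod_empty, ← T_zero, T_apply]
      split_ifs <;> norm_num
    · simp
  | succ n ih =>
    obtain ⟨i1, i2, i3⟩ := ih (fun j => P j.castSucc) (fun j => M j.castSucc)
      (fun j => hM _) (fun j => hP0 _) (fun j => hPM _) (fun j => hP1 _) fun j => y j.castSucc
    have hlast := constCoeff_mul_pow_le hl (hM (Fin.last n)) (hP0 _) (hPM _) (hP1 _)
      (y (Fin.last n)) _ i2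
    rw [Fin.prod_univ_castSucc, Fin.sum_univ_castSucc, Fin.sum_univ_castSucc (n := n) (f := fun j =>
      M j * 2 ^ (∑ i, if i ≤ j then y i else 0))]
    refine ⟨hlast.1.trans ?_, hlast.2.1, by rw [hlast.2.2, i3, pow_add]⟩
    have hcast : ∀ j : Fin n, (∑ i : Fin (n + 1), if i ≤ j.castSucc then y i else 0) =
        ∑ i : Fin n, if i ≤ j then y i.castSucc else 0 := by
      intro j
      rw [Fin.sum_univ_castSucc, if_neg (Fin.castSucc_lt_last j).not_ge, add_zero]
      rfl
    have htop : (∑ i : Fin (n + 1), if i ≤ Fin.last n then y i else 0) =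
        ∑ i : Fin n, y i.castSucc + y (Fin.last n) := by
      simp only [Fin.le_last, if_true, Fin.sum_univ_castSucc]
    simp only [hcast]
    rw [htop, i3]
    calc _ ≤ (2 * l) ^ y (Fin.last n) * ((2 * l) ^ (∑ j : Fin n, y j.castSucc) * (1 + ∑ j : Fin n,
          M j.castSucc * 2 ^ (∑ i : Fin n, if i ≤ j then y i.castSucc else 0)) +
          M (Fin.last n) * 2 ^ y (Fin.last n) * (4 * l) ^ (∑ j : Fin n, y j.castSucc)) := by
          have : 0 ≤ 2 * l := by linarith
          gcongr
      _ = _ := by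
          rw [show 4 * l = 2 * (2 * l) by ring, mul_pow 2 (2 * l)]
          ring

end LaurentBounds

section LowerBlocks
open LaurentPolynomial

/-- The index of the dyadic block `[2 ^ j, 2 ^ (j + 1))` containing `i + 1`. -/
def lowerBlock (n : ℕ) (i : Fin (2 ^ n - 1)) : Fin n :=
  ⟨Nat.log 2 (i + 1), Nat.log_lt_of_lt_pow (Nat.succ_ne_zero _) (by have := i.isLt; omega)⟩

/-- The sum of the Poisson parameters over a block. -/
def lowerBlockSum (n : ℕ) (j : Fin n) : ℝ :=
  ∑ i : Fin (2 ^ n - 1) with lowerBlock n i = j, 1 / (((i : ℕ) : ℝ) + 1)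

/-- The Poisson parameters, reduced so that they sum to `log 2` over every block. -/
def lowerRate (n : ℕ) (i : Fin (2 ^ n - 1)) : ℝ :=
  Real.log 2 / lowerBlockSum n (lowerBlock n i) * (1 / (((i : ℕ) : ℝ) + 1))

lemma log_two_le_lowerBlockSum (n : ℕ) (j : Fin n) : Real.log 2 ≤ lowerBlockSum n j := by
  refine (dyadic_sum_bounds j).2.trans ?_
  have himage : lowerBlockSum n j = ∑ i ∈ (Finset.univ.filter fun i => lowerBlock n i = j).image
      (fun i : Fin (2 ^ n - 1) => (i : ℕ) + 1), 1 / (i : ℝ) := by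
    rw [Finset.sum_image fun _ _ _ _ h => Fin.ext (Nat.succ_injective h), lowerBlockSum]
    exact Finset.sum_congr rfl fun i _ => by push_cast; rfl
  rw [himage]
  · refine Finset.sum_le_sum_of_subset_of_nonneg (fun i hi => ?_) fun i _ _ => by positivity
    rw [Finset.mem_Ico] at hi
    have hj : 2 ^ ((j : ℕ) + 1) ≤ 2 ^ n := Nat.pow_le_pow_right (by norm_num) j.isLt
    have hi0 : 0 < 2 ^ (j : ℕ) := by positivity
    refine Finset.mem_image.2 ⟨⟨i - 1, by omega⟩, Finset.mem_filter.2 ⟨Finset.mem_univ _, ?_⟩, ?_⟩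
    · ext
      simp only [lowerBlock]
      rw [Nat.sub_add_cancel (by omega)]
      exact (Nat.log_eq_iff (Or.inr ⟨by norm_num, by omega⟩)).2 hi
    · simp only
      omega

lemma lowerRate_nonneg (n : ℕ) (i : Fin (2 ^ n - 1)) : 0 ≤ lowerRate n i := by
  have h1 := Real.log_pos (by norm_num : (1 : ℝ) < 2)
  have h2 := log_two_le_lowerBlockSum n (lowerBlock n i)
  exact mul_nonneg (div_nonneg h1.le (h1.le.trans h2)) (by positivity)

lemma lowerRate_le (n : ℕ) (i : Fin (2 ^ n - 1)) : lowerRate n i ≤ 1 / (((i : ℕ) : ℝ) + 1) := by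
  have h1 := Real.log_pos (by norm_num : (1 : ℝ) < 2)
  have h2 := log_two_le_lowerBlockSum n (lowerBlock n i)
  exact mul_le_of_le_one_left (by positivity) ((div_le_one (h1.trans_le h2)).2 h2)

lemma lowerRate_le_inv_two_pow (n : ℕ) (i : Fin (2 ^ n - 1)) :
    lowerRate n i ≤ (2 ^ (lowerBlock n i : ℕ))⁻¹ := by
  refine (lowerRate_le n i).trans ?_
  rw [one_div]
  gcongr
  have := Nat.pow_log_le_self 2 (Nat.succ_ne_zero (i : ℕ))
  exact_mod_cast this

lemma sum_lowerRate (n : ℕ) (j : Fin n) :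
    ∑ i : Fin (2 ^ n - 1) with lowerBlock n i = j, lowerRate n i = Real.log 2 := by
  have h1 := Real.log_pos (by norm_num : (1 : ℝ) < 2)
  have h2 := log_two_le_lowerBlockSum n j
  calc _ = ∑ i : Fin (2 ^ n - 1) with lowerBlock n i = j,
        Real.log 2 / lowerBlockSum n j * (1 / (((i : ℕ) : ℝ) + 1)) := by
        refine Finset.sum_congr rfl fun i hi => ?_
        rw [lowerRate, (Finset.mem_filter.1 hi).2]
    _ = Real.log 2 := by
        rw [← Finset.mul_sum, ← lowerBlockSum]
        exact div_mul_cancel₀ _ (h1.trans_le h2).ne'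

/-- The non-constant part of the correlation polynomial of a block. -/
def blockCorrelation (n : ℕ) (j : Fin n) : LaurentPolynomial ℝ :=
  ∑ i : Fin (2 ^ n - 1) with lowerBlock n i = j,
    lowerRate n i • (T (((i : ℕ) + 1 : ℕ) : ℤ) + T (-(((i : ℕ) + 1 : ℕ) : ℤ)))

lemma sum_rate_smul_correlationFactor (n : ℕ) (j : Fin n) :
    ∑ i : Fin (2 ^ n - 1) with lowerBlock n i = j, lowerRate n i • correlationFactor ((i : ℕ) + 1) =
      C (2 * Real.log 2) + blockCorrelation n j := by
  simp only [correlationFactor, smul_add (_ : ℝ) (2 : LaurentPolynomial ℝ)]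
  rw [Finset.sum_add_distrib, blockCorrelation, ← Finset.sum_smul, sum_lowerRate, smul_eq_C_mul,
    map_mul, mul_comm, map_ofNat C 2]

lemma evalOne_blockCorrelation (n : ℕ) (j : Fin n) :
    evalOne (blockCorrelation n j) = 2 * Real.log 2 := by
  rw [blockCorrelation, map_sum, ← sum_lowerRate n j, Finset.mul_sum]
  refine Finset.sum_congr rfl fun i _ => ?_
  rw [evalOne_smul, map_add, evalOne_T, evalOne_T]
  ring

lemma coeff_blockCorrelation (n : ℕ) (j : Fin n) (a : ℤ) :
    (blockCorrelation n j).coeff a = ∑ i : Fin (2 ^ n - 1) with lowerBlock n i = j,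
      if (i : ℕ) + 1 = a.natAbs then lowerRate n i else 0 := by
  rw [blockCorrelation, AddMonoidAlgebra.coeff_sum, Finsupp.finsetSum_apply]
  refine Finset.sum_congr rfl fun i _ => ?_
  rw [AddMonoidAlgebra.coeff_smul_apply, AddMonoidAlgebra.coeff_add, Finsupp.add_apply, T_apply,
    T_apply, smul_eq_mul]
  by_cases h1 : (((i : ℕ) + 1 : ℕ) : ℤ) = a
  · rw [if_pos h1, if_neg (by omega), if_pos (by omega)]
    ring
  · by_cases h2 : -(((i : ℕ) + 1 : ℕ) : ℤ) = a
    · rw [if_neg h1, if_pos h2, if_pos (by omega)]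
      ring
    · rw [if_neg h1, if_neg h2, if_neg (by omega)]
      ring

lemma coeff_blockCorrelation_nonneg (n : ℕ) (j : Fin n) (a : ℤ) :
    0 ≤ (blockCorrelation n j).coeff a := by
  rw [coeff_blockCorrelation]
  refine Finset.sum_nonneg fun i _ => ?_
  split_ifs
  · exact lowerRate_nonneg n i
  · exact le_rfl

lemma coeff_blockCorrelation_le (n : ℕ) (j : Fin n) (a : ℤ) :
    (blockCorrelation n j).coeff a ≤ (2 ^ (j : ℕ))⁻¹ := by
  rw [coeff_blockCorrelation, ← Finset.sum_filter]
  have hle : ∀ i ∈ (Finset.univ.filter fun i => lowerBlock n i = j).filter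
      (fun i : Fin (2 ^ n - 1) => (i : ℕ) + 1 = a.natAbs), lowerRate n i ≤ (2 ^ (j : ℕ))⁻¹ := by
    intro i hi
    have := lowerRate_le_inv_two_pow n i
    rwa [(Finset.mem_filter.1 (Finset.mem_filter.1 hi).1).2] at this
  have hcard : ((Finset.univ.filter fun i => lowerBlock n i = j).filter
      (fun i : Fin (2 ^ n - 1) => (i : ℕ) + 1 = a.natAbs)).card ≤ 1 := by
    refine Finset.card_le_one.2 fun i hi i' hi' => ?_
    have h1 := (Finset.mem_filter.1 hi).2
    have h2 := (Finset.mem_filter.1 hi').2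
    ext
    omega
  refine (Finset.sum_le_card_nsmul _ _ _ hle).trans ?_
  rw [nsmul_eq_mul]
  exact mul_le_of_le_one_left (by positivity) (by exact_mod_cast hcard)

lemma le_sum_blockFiber_lowerBlock (n : ℕ) (y : Fin n → ℕ) {τ : ℝ} (hτ : 0 < τ) :
    Real.exp (-(harmonic (2 ^ n - 1) : ℝ)) * ((∏ j, ((y j).factorial : ℝ)⁻¹) *
      ((2 * Real.log 2) ^ (∑ j, y j) * (2 / τ -
        (1 + ∑ j : Fin n, (2 ^ (j : ℕ))⁻¹ * 2 ^ (∑ i, if i ≤ j then y i else 0)) / τ ^ 2))) ≤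
    ∑ c ∈ blockFiber (lowerBlock n) y,
      ((Lset (2 ^ n - 1) c).card : ℝ) * pmfVec (2 ^ n - 1) c := by
  let w : (Fin (2 ^ n - 1) → ℕ) → ℝ := fun c => ∏ i, (((c i).factorial : ℝ)⁻¹ * lowerRate n i ^ c i)
  have hw0 : ∀ c, 0 ≤ w c := fun c =>
    Finset.prod_nonneg fun i _ => mul_nonneg (by positivity) (pow_nonneg (lowerRate_nonneg n i) _)
  have hw : ∀ c, Real.exp (-(harmonic (2 ^ n - 1) : ℝ)) * w c ≤ pmfVec (2 ^ n - 1) c := by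
    intro c
    rw [pmfVec_eq]
    refine mul_le_mul_of_nonneg_left (Finset.prod_le_prod (fun i _ => mul_nonneg (by positivity)
      (pow_nonneg (lowerRate_nonneg n i) _)) fun i _ => mul_le_mul_of_nonneg_left
      (pow_le_pow_left₀ (lowerRate_nonneg n i) (lowerRate_le n i) _) (by positivity)) (by positivity)
  have hl : 1 ≤ 2 * Real.log 2 := by
    have := Real.log_two_gt_d9
    linarith
  have hsum : ∀ c ∈ blockFiber (lowerBlock n) y, ∑ i, c i = ∑ j, y j := by
    intro c hc
    have h := sum_blockSums (lowerBlock n) c fun _ => 1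
    simp only [one_mul, (mem_blockFiber _ _ _).1 hc] at h
    exact h.symm
  have hmass : ∑ c ∈ blockFiber (lowerBlock n) y, w c =
      (∏ j, ((y j).factorial : ℝ)⁻¹) * Real.log 2 ^ (∑ j, y j) := by
    have h := sum_blockFiber (lowerBlock n) y (lowerRate n)
    simp only [smul_eq_mul, sum_lowerRate] at h
    rw [h, Finset.prod_mul_distrib, Finset.prod_pow_eq_pow_sum]
  have hcorr : ∑ c ∈ blockFiber (lowerBlock n) y,
      w c * constCoeff (∏ i : Fin (2 ^ n - 1), correlationFactor ((i : ℕ) + 1) ^ c i) =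
      (∏ j, ((y j).factorial : ℝ)⁻¹) *
        constCoeff (∏ j, (C (2 * Real.log 2) + blockCorrelation n j) ^ y j) := by
    have h := sum_blockFiber (lowerBlock n) y
      fun i : Fin (2 ^ n - 1) => lowerRate n i • correlationFactor ((i : ℕ) + 1)
    simp only [sum_rate_smul_correlationFactor, smul_pow, smul_smul, Finset.prod_smul] at h
    have h' := congrArg constCoeff h
    rw [map_sum, map_smul, smul_eq_mul] at h'
    rw [← h']
    exact Finset.sum_congr rfl fun c _ => by rw [map_smul, smul_eq_mul]
  have hle := (constCoeff_prod_le hl n (blockCorrelation n) (fun j => (2 ^ (j : ℕ))⁻¹)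
    (fun j => by positivity) (coeff_blockCorrelation_nonneg n) (coeff_blockCorrelation_le n)
    (evalOne_blockCorrelation n) y).1
  calc _ ≤ Real.exp (-(harmonic (2 ^ n - 1) : ℝ)) *
        (2 * 2 ^ (∑ j, y j) / τ * ∑ c ∈ blockFiber (lowerBlock n) y, w c -
          (∑ c ∈ blockFiber (lowerBlock n) y,
            w c * constCoeff (∏ i : Fin (2 ^ n - 1), correlationFactor ((i : ℕ) + 1) ^ c i)) / τ ^ 2) := by
        refine mul_le_mul_of_nonneg_left ?_ (by positivity)
        rw [hmass, hcorr, mul_div_assoc]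
        have := mul_le_mul_of_nonneg_left (div_le_div_of_nonneg_right hle (sq_nonneg τ))
          (show 0 ≤ ∏ j, ((y j).factorial : ℝ)⁻¹ from Finset.prod_nonneg fun j _ => by positivity)
        rw [mul_div_assoc] at this
        rw [mul_pow] at this ⊢
        linear_combination this
    _ = ∑ c ∈ blockFiber (lowerBlock n) y, Real.exp (-(harmonic (2 ^ n - 1) : ℝ)) * w c *
          (2 * 2 ^ (∑ i, c i) / τ -
            constCoeff (∏ i : Fin (2 ^ n - 1), correlationFactor ((i : ℕ) + 1) ^ c i) / τ ^ 2) := by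
        rw [Finset.mul_sum, Finset.sum_div, ← Finset.sum_sub_distrib, Finset.mul_sum]
        refine Finset.sum_congr rfl fun c hc => ?_
        rw [hsum c hc]
        ring
    _ ≤ ∑ c ∈ blockFiber (lowerBlock n) y, Real.exp (-(harmonic (2 ^ n - 1) : ℝ)) * w c *
          ((Lset (2 ^ n - 1) c).card : ℝ) :=
        Finset.sum_le_sum fun c _ => mul_le_mul_of_nonneg_left (le_card_Lset _ c hτ)
          (mul_nonneg (by positivity) (hw0 c))
    _ ≤ _ := by
        refine Finset.sum_le_sum fun c _ => ?_
        rw [mul_comm]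
        exact mul_le_mul_of_nonneg_left (hw c) (Nat.cast_nonneg _)

end LowerBlocks

/-- The sequences whose depth, started from `0`, stays non-negative and ends at `0`. -/
def goodPaths (n : ℕ) : Finset (Fin n → ℕ) :=
  {y ∈ Fintype.piFinset fun _ : Fin n => Finset.range (n + 1) |
    (∀ t ≤ n, 0 ≤ depth 0 y t) ∧ depth 0 y n = 0}

lemma depth_length {n : ℕ} (z : ℤ) (y : Fin n → ℕ) :
    depth z y n = z + n - ((∑ i, y i : ℕ) : ℤ) := by
  simp [depth]

lemma mem_goodPaths {n : ℕ} {y : Fin n → ℕ} :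
    y ∈ goodPaths n ↔ (∀ t ≤ n, 0 ≤ depth 0 y t) ∧ depth 0 y n = 0 := by
  refine ⟨fun h => (Finset.mem_filter.1 h).2, fun h => Finset.mem_filter.2 ⟨?_, h⟩⟩
  refine Fintype.mem_piFinset.2 fun i => Finset.mem_range.2 ?_
  have h1 := h.2
  have h2 := Finset.single_le_sum (fun j _ => Nat.zero_le (y j)) (Finset.mem_univ i)
  rw [depth_length] at h1
  omega

lemma sum_of_mem_goodPaths {n : ℕ} {y : Fin n → ℕ} (hy : y ∈ goodPaths n) : ∑ i, y i = n := by
  have h := (mem_goodPaths.1 hy).2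
  rw [depth_length] at h
  omega

lemma sum_goodPaths_through {n j : ℕ} (b : ℕ) (hj : j ≤ n) :
    ∑ y ∈ goodPaths n with depth 0 y j = b, ∏ i, ((y i).factorial : ℝ)⁻¹ =
      pathWeight j 0 b * pathWeight (n - j) b 0 := by
  have hnn : ∀ y : Fin n → ℕ, 0 ≤ ∏ i, ((y i).factorial : ℝ)⁻¹ :=
    fun y => Finset.prod_nonneg fun i _ => by positivity
  have hof : ∀ y : Fin n → ℕ,
      ENNReal.ofReal (∏ i, ((y i).factorial : ℝ)⁻¹) = invFactorials y := by
    intro y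
    rw [ENNReal.ofReal_prod_of_nonneg fun i _ => by positivity]
    exact Finset.prod_congr rfl fun i _ => ofReal_inv_factorial _
  rw [← ENNReal.ofReal_eq_ofReal_iff (Finset.sum_nonneg fun y _ => hnn y)
    (mul_nonneg (pathWeight_nonneg _ _ _) (pathWeight_nonneg _ _ _)),
    ENNReal.ofReal_sum_of_nonneg fun y _ => hnn y, ← tsum_stay_through n j 0 b 0 hj]
  simp only [hof, Nat.cast_zero]
  rw [tsum_eq_sum (s := goodPaths n), Finset.sum_filter]
  · refine Finset.sum_congr rfl fun y hy => ?_
    have := mem_goodPaths.1 hy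
    exact if_congr ⟨fun h => ⟨this.1, h, this.2⟩, fun h => h.2.1⟩ rfl rfl
  · intro y hy
    rw [mem_goodPaths] at hy
    exact if_neg fun h => hy ⟨h.1, h.2.2⟩

lemma sum_goodPaths (n : ℕ) :
    ∑ y ∈ goodPaths n, ∏ i, ((y i).factorial : ℝ)⁻¹ = pathWeight n 0 0 := by
  have h0 := sum_goodPaths_through (n := n) 0 (Nat.zero_le n)
  have h1 := sum_goodPaths_through (n := n) 0 le_rfl
  simp only [depth_zero, Nat.cast_zero, Finset.filter_true, Nat.sub_zero, Nat.sub_self] at h0 h1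
  have h2 : pathWeight 0 0 0 = 1 := by simp [pathWeight]
  rw [h0, h2, one_mul]

lemma inv_two_pow_mul_of_mem_goodPaths {n : ℕ} {y : Fin n → ℕ} (hy : y ∈ goodPaths n)
    (j : Fin n) :
    ((2 : ℝ) ^ (j : ℕ))⁻¹ * 2 ^ (∑ i, if i ≤ j then y i else 0) =
      2 * (1 / 2) ^ (depth 0 y ((j : ℕ) + 1)).toNat := by
  have h := (mem_goodPaths.1 hy).1 (j + 1) j.isLt
  have hd : depth 0 y ((j : ℕ) + 1) =
      (j : ℕ) + 1 - ((∑ i : Fin n, if i ≤ j then y i else 0 : ℕ) : ℤ) := by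
    simp [depth]
  obtain ⟨d, hd'⟩ := Int.eq_ofNat_of_zero_le h
  rw [hd'] at hd ⊢
  have hs : (j : ℕ) + 1 = d + ∑ i : Fin n, if i ≤ j then y i else 0 := by omega
  rw [Int.toNat_natCast, one_div, inv_pow, inv_mul_eq_div, ← div_eq_mul_inv,
    div_eq_div_iff (by positivity) (by positivity), ← pow_succ', ← pow_add, hs, add_comm]

lemma toNat_depth_mem_range {n t : ℕ} (y : Fin n → ℕ) (ht : t ≤ n) :
    (depth 0 y t).toNat ∈ Finset.range (n + 1) := by
  have : 0 ≤ ∑ i : Fin n, if (i : ℕ) < t then (y i : ℤ) else 0 :=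
    Finset.sum_nonneg fun i _ => by split_ifs <;> positivity
  rw [Finset.mem_range, depth]
  omega

lemma rpow_neg_three_halves_mul_le {u v w : ℝ} (hu : 0 < u) (hv : 0 < v) (hw : 0 < w)
    (h : w ≤ u + v) : u ^ (-(3 / 2) : ℝ) * v ^ (-(3 / 2) : ℝ) ≤
      4 * w ^ (-(3 / 2) : ℝ) * (u ^ (-(3 / 2) : ℝ) + v ^ (-(3 / 2) : ℝ)) := by
  have h4 : ((1 : ℝ) / 2) ^ (-(3 / 2) : ℝ) ≤ 4 := by
    calc ((1 : ℝ) / 2) ^ (-(3 / 2) : ℝ) ≤ ((1 : ℝ) / 2) ^ (-2 : ℝ) :=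
          Real.rpow_le_rpow_of_exponent_ge (by norm_num) (by norm_num) (by norm_num)
      _ = 4 := by
          rw [Real.rpow_neg (by norm_num), show (2 : ℝ) = ((2 : ℕ) : ℝ) by norm_num,
            Real.rpow_natCast]
          norm_num
  have key : ∀ x : ℝ, 1 / 2 * w ≤ x → x ^ (-(3 / 2) : ℝ) ≤ 4 * w ^ (-(3 / 2) : ℝ) := by
    intro x hx
    calc _ ≤ (1 / 2 * w) ^ (-(3 / 2) : ℝ) :=
          Real.rpow_le_rpow_of_nonpos (by positivity) hx (by norm_num)
      _ = (1 / 2) ^ (-(3 / 2) : ℝ) * w ^ (-(3 / 2) : ℝ) :=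
          Real.mul_rpow (by norm_num) hw.le
      _ ≤ _ := by gcongr
  have hu' : 0 < u ^ (-(3 / 2) : ℝ) := by positivity
  have hv' : 0 < v ^ (-(3 / 2) : ℝ) := by positivity
  have hw' : 0 < w ^ (-(3 / 2) : ℝ) := by positivity
  rcases le_total (1 / 2 * w) u with h1 | h1
  · have := mul_le_mul_of_nonneg_right (key u h1) hv'.le
    nlinarith [mul_pos hw' hu']
  · have := mul_le_mul_of_nonneg_left (key v (by linarith)) hu'.le
    nlinarith [mul_pos hw' hv']

lemma sum_rpow_convolution_le :
    ∃ K : ℝ, 0 < K ∧ ∀ n : ℕ, ∑ j ∈ Finset.range n, (((j + 1 : ℕ) : ℝ) + 1) ^ (-(3 / 2) : ℝ) *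
      (((n - (j + 1) : ℕ) : ℝ) + 1) ^ (-(3 / 2) : ℝ) ≤ K * ((n : ℝ) + 1) ^ (-(3 / 2) : ℝ) := by
  have hs : Summable fun j : ℕ => ((j : ℝ) + 1) ^ (-(3 / 2) : ℝ) := by
    have h := (summable_nat_add_iff 1).2 (Real.summable_nat_rpow.2
      (show (-(3 / 2) : ℝ) < -1 by norm_num))
    simpa only [Nat.cast_add, Nat.cast_one] using h
  have hnn : ∀ j : ℕ, 0 ≤ ((j : ℝ) + 1) ^ (-(3 / 2) : ℝ) := fun j => by positivity
  have hS : 0 < ∑' j : ℕ, ((j : ℝ) + 1) ^ (-(3 / 2) : ℝ) :=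
    hs.tsum_pos hnn 0 (by positivity)
  refine ⟨8 * ∑' j : ℕ, ((j : ℝ) + 1) ^ (-(3 / 2) : ℝ), by positivity, fun n => ?_⟩
  calc _ ≤ ∑ j ∈ Finset.range n, 4 * ((n : ℝ) + 1) ^ (-(3 / 2) : ℝ) *
        (((j : ℝ) + 1) ^ (-(3 / 2) : ℝ) + (((n - 1 - j : ℕ) : ℝ) + 1) ^ (-(3 / 2) : ℝ)) := by
        refine Finset.sum_le_sum fun j hj => ?_
        rw [Finset.mem_range] at hj
        rw [show n - (j + 1) = n - 1 - j by omega]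
        refine (rpow_neg_three_halves_mul_le (w := (n : ℝ) + 1) (by positivity) (by positivity)
          (by positivity) ?_).trans ?_
        · have : ((n : ℕ) : ℝ) + 1 = ((j + 1 + 1 + (n - 1 - j) : ℕ) : ℝ) := by
            rw [show j + 1 + 1 + (n - 1 - j) = n + 1 by omega]
            push_cast
            ring
          rw [this]
          push_cast
          linarith
        · gcongr 4 * _ * (?_ + _)
          apply Real.rpow_le_rpow_of_nonpos (by positivity) _ (by norm_num)
          push_cast
          linarith
    _ = 8 * ((n : ℝ) + 1) ^ (-(3 / 2) : ℝ) *
        ∑ j ∈ Finset.range n, ((j : ℝ) + 1) ^ (-(3 / 2) : ℝ) := by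
        rw [← Finset.mul_sum, Finset.sum_add_distrib,
          Finset.sum_range_reflect (fun j : ℕ => ((j : ℝ) + 1) ^ (-(3 / 2) : ℝ)) n]
        ring
    _ ≤ 8 * ((n : ℝ) + 1) ^ (-(3 / 2) : ℝ) * ∑' j : ℕ, ((j : ℝ) + 1) ^ (-(3 / 2) : ℝ) := by
        gcongr
        exact hs.sum_le_tsum _ fun j _ => hnn j
    _ = _ := by ring

lemma sum_goodPaths_half_pow_le :
    ∃ K : ℝ, 0 < K ∧ ∀ n j : ℕ, j ≤ n →
      ∑ y ∈ goodPaths n, (∏ i, ((y i).factorial : ℝ)⁻¹) * (1 / 2) ^ (depth 0 y j).toNat ≤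
        K * (Real.exp n * (((j : ℝ) + 1) ^ (-(3 / 2) : ℝ) *
          (((n - j : ℕ) : ℝ) + 1) ^ (-(3 / 2) : ℝ))) := by
  obtain ⟨C, hC, hF⟩ := pathWeight_le
  have hs : Summable fun b : ℕ => ((b : ℝ) + 1) ^ 2 * (5 / 8 : ℝ) ^ b := by
    have h2 := summable_pow_mul_geometric_of_norm_lt_one 2
      (show ‖(5 / 8 : ℝ)‖ < 1 by norm_num)
    have h := (h2.add ((summable_add_mul_geometric (1 / 2) (5 / 8) (by norm_num)
      (by norm_num)).mul_left 2))
    exact h.congr fun b => by ring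
  have hS : 0 < ∑' b : ℕ, ((b : ℝ) + 1) ^ 2 * (5 / 8 : ℝ) ^ b :=
    hs.tsum_pos (fun b => by positivity) 0 (by positivity)
  refine ⟨Real.exp 1 * C * ∑' b : ℕ, ((b : ℝ) + 1) ^ 2 * (5 / 8 : ℝ) ^ b, by positivity,
    fun n j hj => ?_⟩
  rw [← Finset.sum_fiberwise_of_maps_to fun y _ => toNat_depth_mem_range y hj]
  calc _ = ∑ b ∈ Finset.range (n + 1),
        pathWeight j 0 b * pathWeight (n - j) b 0 * (1 / 2) ^ b := by
        refine Finset.sum_congr rfl fun b _ => ?_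
        rw [← sum_goodPaths_through b hj, Finset.sum_mul]
        refine Finset.sum_congr (Finset.filter_congr fun y hy => ?_) fun y hy => ?_
        · have := (mem_goodPaths.1 hy).1 j hj
          omega
        · rw [(Finset.mem_filter.1 hy).2, Int.toNat_natCast]
    _ ≤ ∑ b ∈ Finset.range (n + 1), Real.exp 1 * C * (Real.exp n * (((j : ℝ) + 1) ^ (-(3 / 2) : ℝ) *
          (((n - j : ℕ) : ℝ) + 1) ^ (-(3 / 2) : ℝ))) * (((b : ℝ) + 1) ^ 2 * (5 / 8 : ℝ) ^ b) := by
        refine Finset.sum_le_sum fun b _ => ?_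
        have hexp : Real.exp n = Real.exp j * Real.exp ((n - j : ℕ) : ℝ) := by
          rw [← Real.exp_add, Nat.cast_sub hj, add_sub_cancel]
        calc _ ≤ (b + 1) * (Real.exp 1 * Real.exp j * ((j : ℝ) + 1) ^ (-(3 / 2) : ℝ)) *
              (C * ((0 : ℕ) + 1) * ((b + 1) * (5 / 4) ^ b) * (Real.exp ((n - j : ℕ) : ℝ) *
                (((n - j : ℕ) : ℝ) + 1) ^ (-(3 / 2) : ℝ))) * (1 / 2) ^ b := by
              gcongr
              · exact pathWeight_nonneg _ _ _
              · exact pathWeight_from_zero_le j b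
              · exact hF (n - j) b 0
          _ = _ := by
              rw [hexp, show (5 / 8 : ℝ) = 5 / 4 * (1 / 2) by norm_num, mul_pow, Nat.cast_zero]
              ring
    _ ≤ Real.exp 1 * C * (Real.exp n * (((j : ℝ) + 1) ^ (-(3 / 2) : ℝ) *
          (((n - j : ℕ) : ℝ) + 1) ^ (-(3 / 2) : ℝ))) *
            ∑' b : ℕ, ((b : ℝ) + 1) ^ 2 * (5 / 8 : ℝ) ^ b := by
        rw [← Finset.mul_sum]
        gcongr
        exact hs.sum_le_tsum _ fun b _ => by positivity
    _ = _ := by ring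

lemma sum_goodPaths_correlation_le :
    ∃ K : ℝ, 0 < K ∧ ∀ n : ℕ, ∑ y ∈ goodPaths n, (∏ i, ((y i).factorial : ℝ)⁻¹) *
      (1 + ∑ j : Fin n, ((2 : ℝ) ^ (j : ℕ))⁻¹ * 2 ^ (∑ i, if i ≤ j then y i else 0)) ≤
        K * pathWeight n 0 0 := by
  obtain ⟨K, hK, h⟩ := sum_goodPaths_half_pow_le
  obtain ⟨K', hK', h'⟩ := sum_rpow_convolution_le
  refine ⟨1 + 2 * (K * K'), by positivity, fun n => ?_⟩
  simp only [mul_add, mul_one, Finset.sum_add_distrib]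
  rw [sum_goodPaths, add_mul, one_mul]
  refine add_le_add_right ?_ _
  calc _ = 2 * ∑ j ∈ Finset.range n, ∑ y ∈ goodPaths n,
        (∏ i, ((y i).factorial : ℝ)⁻¹) * (1 / 2) ^ (depth 0 y (j + 1)).toNat := by
        rw [← Fin.sum_univ_eq_sum_range (fun j => ∑ y ∈ goodPaths n,
          (∏ i, ((y i).factorial : ℝ)⁻¹) * (1 / 2) ^ (depth 0 y (j + 1)).toNat) n,
          Finset.sum_comm, Finset.mul_sum]
        refine Finset.sum_congr rfl fun y hy => ?_
        rw [Finset.mul_sum, Finset.mul_sum]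
        refine Finset.sum_congr rfl fun j _ => ?_
        rw [inv_two_pow_mul_of_mem_goodPaths hy]
        ring
    _ ≤ 2 * ∑ j ∈ Finset.range n, K * (Real.exp n * ((((j + 1 : ℕ) : ℝ) + 1) ^ (-(3 / 2) : ℝ) *
          (((n - (j + 1) : ℕ) : ℝ) + 1) ^ (-(3 / 2) : ℝ))) := by
        gcongr with j hj
        exact h n (j + 1) (Finset.mem_range.1 hj)
    _ ≤ 2 * (K * (Real.exp n * (K' * ((n : ℝ) + 1) ^ (-(3 / 2) : ℝ)))) := by
        rw [← Finset.mul_sum, ← Finset.mul_sum]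
        gcongr
        exact h' n
    _ = 2 * (K * K') * (Real.exp n * ((n : ℝ) + 1) ^ (-(3 / 2) : ℝ)) := by ring
    _ ≤ _ := by
        gcongr
        exact le_pathWeight_zero_zero n

lemma le_extendedEL_two_pow_sub_one :
    ∃ c : ℝ, 0 < c ∧ ∀ n : ℕ, ENNReal.ofReal
      (c * ((Real.exp 1 * Real.log 2) ^ n * ((n : ℝ) + 1) ^ (-(3 / 2) : ℝ))) ≤
        extendedEL (2 ^ n - 1) := by
  obtain ⟨K, hK, h⟩ := sum_goodPaths_correlation_le
  have hlog : 0 < Real.log 2 := Real.log_pos (by norm_num)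
  refine ⟨(Real.exp 1 * K)⁻¹, by positivity, fun n => ?_⟩
  have hterm : ∀ c : Fin (2 ^ n - 1) → ℕ,
      0 ≤ ((Lset (2 ^ n - 1) c).card : ℝ) * pmfVec (2 ^ n - 1) c :=
    fun c => mul_nonneg (Nat.cast_nonneg _) (pmfVec_nonneg _ c)
  rw [extendedEL, tsum_eq_tsum_blockFiber (lowerBlock n)]
  refine le_trans ?_ (ENNReal.sum_le_tsum (goodPaths n))
  simp only [← ENNReal.ofReal_sum_of_nonneg fun c _ => hterm c]
  rw [← ENNReal.ofReal_sum_of_nonneg fun y _ => Finset.sum_nonneg fun c _ => hterm c]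
  apply ENNReal.ofReal_le_ofReal
  refine le_trans ?_ (Finset.sum_le_sum fun y _ => le_sum_blockFiber_lowerBlock n y hK)
  have hcast : ((2 ^ n - 1 : ℕ) : ℝ) + 1 = 2 ^ n := by
    rw [← Nat.cast_add_one, Nat.sub_add_cancel Nat.one_le_two_pow]
    push_cast
    rfl
  have hharm := le_exp_neg_harmonic (2 ^ n - 1)
  rw [hcast] at hharm
  have hexp : Real.exp n = Real.exp 1 ^ n := by rw [← Real.exp_nat_mul, mul_one]
  calc _ = 1 / (Real.exp 1 * 2 ^ n) * ((2 * Real.log 2) ^ n *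
        ((Real.exp n * ((n : ℝ) + 1) ^ (-(3 / 2) : ℝ)) / K)) := by
        rw [hexp, mul_pow, mul_pow]
        field_simp
    _ ≤ Real.exp (-(harmonic (2 ^ n - 1) : ℝ)) * ((2 * Real.log 2) ^ n *
        (pathWeight n 0 0 / K)) := by
        gcongr
        exact le_pathWeight_zero_zero n
    _ ≤ Real.exp (-(harmonic (2 ^ n - 1) : ℝ)) * ((2 * Real.log 2) ^ n *
        (2 / K * pathWeight n 0 0 - (K * pathWeight n 0 0) / K ^ 2)) := by
        refine le_of_eq ?_
        field_simp
        ring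
    _ ≤ Real.exp (-(harmonic (2 ^ n - 1) : ℝ)) * ((2 * Real.log 2) ^ n *
        (2 / K * pathWeight n 0 0 - (∑ y ∈ goodPaths n, (∏ i, ((y i).factorial : ℝ)⁻¹) *
          (1 + ∑ j : Fin n, ((2 : ℝ) ^ (j : ℕ))⁻¹ * 2 ^ (∑ i, if i ≤ j then y i else 0))) /
            K ^ 2)) := by
        gcongr
        exact h n
    _ = _ := by
        rw [← sum_goodPaths, Finset.mul_sum, Finset.sum_div, ← Finset.sum_sub_distrib,
          Finset.mul_sum, Finset.mul_sum]
        refine Finset.sum_congr rfl fun y hy => ?_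
        rw [sum_of_mem_goodPaths hy]
        ring

lemma one_sub_delta_pos : 0 < 1 - delta := by
  have h1 := Real.log_two_gt_d9
  have h2 : Real.exp (-1) < Real.log 2 := by
    rw [Real.exp_neg]
    refine inv_lt_of_inv_lt₀ (by linarith) ?_
    have := Real.exp_one_gt_d9
    refine lt_trans ?_ this
    rw [inv_lt_comm₀ (by linarith) (by norm_num)]
    norm_num at h1 ⊢
    linarith
  have h3 := Real.log_lt_log (Real.exp_pos _) h2
  rw [Real.log_exp] at h3
  rw [delta, sub_sub_cancel]
  exact div_pos (by linarith) (by linarith)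

lemma two_pow_rpow_one_sub_delta (n : ℕ) :
    ((2 : ℝ) ^ n) ^ (1 - delta) = (Real.exp 1 * Real.log 2) ^ n := by
  have hlog : 0 < Real.log 2 := Real.log_pos (by norm_num)
  have h : (2 : ℝ) ^ (1 - delta) = Real.exp 1 * Real.log 2 := by
    rw [Real.rpow_def_of_pos (by norm_num), delta, sub_sub_cancel, mul_div_cancel₀ _ hlog.ne',
      Real.exp_add, Real.exp_log hlog]
  rw [← h, ← Real.rpow_natCast, ← Real.rpow_mul (by norm_num), mul_comm, Real.rpow_mul (by norm_num),
    Real.rpow_natCast]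

theorem EL_asymp :
    ∃ C1 C2 : ℝ, 0 < C1 ∧ 0 < C2 ∧
      ∀ k : ℕ, 1 ≤ k →
        C1 * (k : ℝ) ^ ((1 : ℝ) - delta) * (1 + Real.log k) ^ (-(3/2 : ℝ)) ≤ EL k ∧
        EL k ≤ C2 * (k : ℝ) ^ ((1 : ℝ) - delta) * (1 + Real.log k) ^ (-(3/2 : ℝ)) := by
  obtain ⟨c, hc, hlower⟩ := le_extendedEL_two_pow_sub_one
  obtain ⟨C, hC, hupper⟩ := extendedEL_two_pow_le
  have hlog : 0 < Real.log 2 := Real.log_pos (by norm_num)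
  have hlog1 : Real.log 2 < 1 := Real.log_two_lt_d9.trans (by norm_num)
  obtain ⟨A, hA⟩ : ∃ A, A = Real.exp 1 * Real.log 2 := ⟨_, rfl⟩
  have hA0 : 0 < A := hA ▸ by positivity
  have hpow : ∀ n : ℕ, ((2 : ℝ) ^ n) ^ (1 - delta) = A ^ n :=
    fun n => hA ▸ two_pow_rpow_one_sub_delta n
  rw [← hA] at hlower hupper
  refine ⟨c / (A * Real.log 2 ^ (-(3 / 2) : ℝ)), C * A, by positivity, by positivity,
    fun k hk => ?_⟩
  obtain ⟨n, hn⟩ : ∃ n, n = Nat.log 2 k := ⟨_, rfl⟩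
  have hk1 : 2 ^ n ≤ k := hn ▸ Nat.pow_log_le_self 2 (by omega)
  have hk2 : k < 2 ^ (n + 1) := hn ▸ Nat.lt_pow_succ_log_self (by norm_num) k
  have hk1' : (2 : ℝ) ^ n ≤ k := by exact_mod_cast hk1
  have hk2' : (k : ℝ) ≤ 2 ^ (n + 1) := by exact_mod_cast hk2.le
  have hk0 : (0 : ℝ) < k := by exact_mod_cast hk
  have hl1 := Real.log_le_log (by positivity) hk1'
  have hl2 := Real.log_le_log hk0 hk2'
  rw [Real.log_pow] at hl1 hl2
  push_cast at hl2
  have hlogk : 0 ≤ Real.log k := Real.log_nonneg (by exact_mod_cast hk)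
  have hk3 := Real.rpow_le_rpow (by positivity) hk1' one_sub_delta_pos.le
  have hk4 := Real.rpow_le_rpow hk0.le hk2' one_sub_delta_pos.le
  rw [hpow] at hk3 hk4
  have hup := (extendedEL_mono hk2.le).trans (hupper (n + 1))
  have hlow := (hlower n).trans (extendedEL_mono ((Nat.sub_le _ _).trans hk1))
  rw [EL_eq_toReal]
  constructor
  · refine le_trans ?_ ((ENNReal.ofReal_le_iff_le_toReal
      (ne_top_of_le_ne_top ENNReal.ofReal_ne_top hup)).1 hlow)
    calc _ ≤ c / (A * Real.log 2 ^ (-(3 / 2) : ℝ)) * A ^ (n + 1) *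
          (Real.log 2 * ((n : ℝ) + 1)) ^ (-(3 / 2) : ℝ) := by
          gcongr ?_ * ?_ * ?_
          apply Real.rpow_le_rpow_of_nonpos (by positivity) _ (by norm_num)
          linarith
      _ = _ := by
          rw [Real.mul_rpow hlog.le (by positivity), pow_succ]
          field_simp
  · refine (ENNReal.toReal_le_of_le_ofReal (by positivity) hup).trans ?_
    calc _ = C * A * A ^ n * (((n + 1 : ℕ) : ℝ) + 1) ^ (-(3 / 2) : ℝ) := by
          rw [pow_succ]
          ring
      _ ≤ _ := by
          gcongr ?_ * ?_ * ?_
          apply Real.rpow_le_rpow_of_nonpos (by positivity) _ (by norm_num)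
          push_cast
          nlinarith
end
end

section
/- For every fixed positive integer k, the limit i(∞,k) = lim_{n→∞} i(n,k) exists and equals P(k ∈ 𝓛(X_k)), the probability that k belongs to the random set 𝓛(X_k). -/
open scoped BigOperators

noncomputable section

/-- `π` has an invariant set of size `k`. -/
def hasInvariantSet (n k : ℕ) (π : Equiv.Perm (Fin n)) : Prop :=
  ∃ s : Finset (Fin n), s.card = k ∧ ∀ x ∈ s, π x ∈ s

/-- `i(n,k)`: the proportion of permutations of `{1,…,n}` having an invariant set of size `k`. -/
def iProp (n k : ℕ) : ℝ :=
  (Nat.card {π : Equiv.Perm (Fin n) // hasInvariantSet n k π} : ℝ) /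
    (Nat.card (Equiv.Perm (Fin n)) : ℝ)

lemma hasSum_mul_of_summable_norm {ι κ : Type*} {f : ι → ℝ} {g : κ → ℝ} {a b : ℝ}
    (hf : HasSum f a) (hg : HasSum g b) (hf' : Summable fun i => ‖f i‖)
    (hg' : Summable fun j => ‖g j‖) : HasSum (fun p : ι × κ => f p.1 * g p.2) (a * b) :=
  hf.mul hg (hf'.mul_norm hg').of_norm

/-- The product over the coordinates of summable families is summable over all vectors of
indices, and its sum is the product of the sums. -/
lemma summable_norm_and_hasSum_pi_prod {k : ℕ} (f : Fin k → ℕ → ℝ)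
    (hf : ∀ i, Summable fun a => ‖f i a‖) :
    (Summable fun c : Fin k → ℕ => ‖∏ i, f i (c i)‖) ∧
      HasSum (fun c : Fin k → ℕ => ∏ i, f i (c i)) (∏ i, ∑' a, f i a) := by
  induction k with
  | zero => exact ⟨(hasSum_fintype _).summable, by simp⟩
  | succ k ih =>
    obtain ⟨h1, h2⟩ := ih (fun i => f i.succ) fun i => hf i.succ
    constructor
    · rw [← (Fin.consEquiv fun _ : Fin (k + 1) => ℕ).summable_iff]
      refine ((hf 0).mul_norm h1).congr fun p => ?_
      simp [Fin.prod_univ_succ]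
    · rw [← (Fin.consEquiv fun _ : Fin (k + 1) => ℕ).hasSum_iff, Fin.prod_univ_succ]
      have h4 := hasSum_mul_of_summable_norm (hf 0).of_norm.hasSum h2 (hf 0) h1
      have h5 : ((fun c : Fin (k + 1) → ℕ => ∏ i, f i (c i)) ∘
          (Fin.consEquiv fun _ : Fin (k + 1) => ℕ)) =
          fun p : ℕ × (Fin k → ℕ) => f 0 p.1 * ∏ i, f i.succ (p.2 i) := by
        ext p
        simp [Fin.prod_univ_succ]
      rw [h5]
      exact h4

/-- `∏ x_i ^ c_i / c_i!`. -/
def expWeight {k : ℕ} (x : Fin k → ℝ) (c : Fin k → ℕ) : ℝ := ∏ i, x i ^ c i / (c i).factorial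

lemma expWeight_hasSum {k : ℕ} (x : Fin k → ℝ) :
    (Summable fun c => ‖expWeight x c‖) ∧ HasSum (expWeight x) (Real.exp (∑ i, x i)) := by
  have h := summable_norm_and_hasSum_pi_prod (fun i a => x i ^ a / (a.factorial : ℝ))
    fun i => (NormedSpace.norm_expSeries_div_summable (x i))
  refine ⟨h.1, ?_⟩
  rw [Real.exp_sum]
  simp only [Real.exp_eq_exp_ℝ, NormedSpace.exp_eq_tsum_div]
  exact h.2

/-- `∑ j c_j` over `j ∈ {1,…,k}`. -/
def totalSize {k : ℕ} (c : Fin k → ℕ) : ℕ := ∑ j : Fin k, ((j : ℕ) + 1) * c j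

lemma totalSize_add {k : ℕ} (c d : Fin k → ℕ) : totalSize (c + d) = totalSize c + totalSize d := by
  simp [totalSize, mul_add, Finset.sum_add_distrib]

lemma le_totalSize {k : ℕ} (c : Fin k → ℕ) (j : Fin k) : c j ≤ totalSize c :=
  (Nat.le_mul_of_pos_left _ (Nat.succ_pos _)).trans
    (Finset.single_le_sum (f := fun j : Fin k => ((j : ℕ) + 1) * c j) (fun _ _ => Nat.zero_le _)
      (Finset.mem_univ j))

/-- The vectors of total size at most `n`. -/
def boundedSize (k n : ℕ) : Finset (Fin k → ℕ) :=
  (Fintype.piFinset fun _ => Finset.range (n + 1)).filter fun c => totalSize c ≤ n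

lemma mem_boundedSize {k n : ℕ} {c : Fin k → ℕ} : c ∈ boundedSize k n ↔ totalSize c ≤ n := by
  simp only [boundedSize, Finset.mem_filter, Fintype.mem_piFinset, Finset.mem_range,
    and_iff_right_iff_imp]
  intro h j
  have := le_totalSize c j
  omega

lemma tendsto_boundedSize (k : ℕ) : Filter.Tendsto (boundedSize k) Filter.atTop Filter.atTop := by
  refine Filter.tendsto_atTop_finset_of_monotone (fun m n h c => ?_) fun c => ⟨totalSize c, ?_⟩
  · simp only [mem_boundedSize]; omega
  · simp [mem_boundedSize]

lemma sum_expWeight_neg_mul {k : ℕ} (x : Fin k → ℝ) (d : Fin k → ℕ) :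
    ∑ c ∈ Finset.Iic d, expWeight (-x) c * expWeight x (d - c) = if d = 0 then 1 else 0 := by
  have hI : Finset.Iic d = Fintype.piFinset fun j => Finset.range (d j + 1) := by
    ext c; simp [Pi.le_def]
  have h1 (y : ℝ) (n : ℕ) : ∑ a ∈ Finset.range (n + 1),
      (-y) ^ a / (a.factorial : ℝ) * (y ^ (n - a) / ((n - a).factorial : ℝ)) =
        if n = 0 then 1 else 0 := by
    have h2 : ((-y + y) ^ n) / (n.factorial : ℝ) = if n = 0 then 1 else 0 := by
      rcases eq_or_ne n 0 with rfl | hn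
      · simp
      · simp [hn]
    rw [← h2, add_pow, Finset.sum_div]
    refine Finset.sum_congr rfl fun a ha => ?_
    have ha' : a ≤ n := Nat.lt_succ_iff.mp (Finset.mem_range.mp ha)
    rw [Nat.cast_choose ℝ ha']
    have := Nat.factorial_ne_zero n
    field_simp
  simp only [expWeight, ← Finset.prod_mul_distrib, hI, Pi.neg_apply, Pi.sub_apply]
  rw [← Finset.prod_univ_sum (fun j => Finset.range (d j + 1)) fun j a =>
    (-x j) ^ a / (a.factorial : ℝ) * (x j ^ (d j - a) / ((d j - a).factorial : ℝ))]
  simp only [h1]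
  simp [Finset.prod_ite_zero, funext_iff]

/-- Inversion of a convolution with `expWeight x`. -/
lemma eq_sum_expWeight_neg {k : ℕ} (x : Fin k → ℝ) (U : ℕ → ℝ)
    (hU : ∀ n, ∑ c ∈ boundedSize k n, expWeight x c * U (n - totalSize c) = 1) (n : ℕ) :
    U n = ∑ c ∈ boundedSize k n, expWeight (-x) c := by
  have h1 : ∑ c ∈ boundedSize k n, expWeight (-x) c =
      ∑ c ∈ boundedSize k n, ∑ c' ∈ boundedSize k (n - totalSize c),
        expWeight (-x) c * (expWeight x c' * U (n - totalSize c - totalSize c')) := by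
    refine Finset.sum_congr rfl fun c _ => ?_
    rw [← Finset.mul_sum, hU, mul_one]
  have h2 : ∑ c ∈ boundedSize k n, ∑ c' ∈ boundedSize k (n - totalSize c),
        expWeight (-x) c * (expWeight x c' * U (n - totalSize c - totalSize c')) =
      ∑ d ∈ boundedSize k n, ∑ c ∈ Finset.Iic d,
        expWeight (-x) c * expWeight x (d - c) * U (n - totalSize d) := by
    rw [Finset.sum_sigma', Finset.sum_sigma']
    refine Finset.sum_bij' (fun p _ => ⟨p.1 + p.2, p.1⟩) (fun p _ => ⟨p.2, p.1 - p.2⟩)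
      ?_ ?_ ?_ ?_ ?_
    · rintro ⟨c, c'⟩ h
      simp only [Finset.mem_sigma, mem_boundedSize, Finset.mem_Iic, totalSize_add] at h ⊢
      exact ⟨by omega, le_self_add⟩
    · rintro ⟨d, c⟩ h
      simp only [Finset.mem_sigma, mem_boundedSize, Finset.mem_Iic] at h ⊢
      have := totalSize_add c (d - c)
      rw [add_tsub_cancel_of_le h.2] at this
      omega
    · rintro ⟨c, c'⟩ h
      simp
    · rintro ⟨d, c⟩ h
      simp only [Finset.mem_sigma, mem_boundedSize, Finset.mem_Iic] at h
      simp [add_tsub_cancel_of_le h.2]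
    · rintro ⟨c, c'⟩ h
      simp [totalSize_add, Nat.sub_sub, mul_assoc]
  rw [h1, h2]
  simp_rw [← Finset.sum_mul, sum_expWeight_neg_mul]
  simp [mem_boundedSize, totalSize]

lemma tendsto_of_convolution {k : ℕ} (x : Fin k → ℝ) (U : ℕ → ℝ)
    (hU : ∀ n, ∑ c ∈ boundedSize k n, expWeight x c * U (n - totalSize c) = 1) :
    Filter.Tendsto U Filter.atTop (nhds (Real.exp (-∑ i, x i))) := by
  rw [funext (eq_sum_expWeight_neg x U hU), ← Finset.sum_neg_distrib]
  exact (expWeight_hasSum (-x)).2.comp (tendsto_boundedSize k)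

/-- The proportion of permutations with cycle lengths `s` (fixed points included). -/
def cycleWeight (s : Multiset ℕ) : ℝ :=
  ∏ i ∈ s.toFinset, (1 / (i : ℝ)) ^ s.count i / (s.count i).factorial

lemma cycleWeight_add_of_disjoint {s t : Multiset ℕ} (h : Disjoint s t) :
    cycleWeight (s + t) = cycleWeight s * cycleWeight t := by
  have hd : Disjoint s.toFinset t.toFinset := Multiset.disjoint_toFinset.2 h
  rw [cycleWeight, Multiset.toFinset_add, Finset.prod_union hd]
  congr 1 <;> refine Finset.prod_congr rfl fun i hi => ?_
  · have : t.count i = 0 := by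
      simpa using fun h' => Finset.disjoint_left.1 hd hi (Multiset.mem_toFinset.2 h')
    simp [this]
  · have : s.count i = 0 := by
      simpa using fun h' => Finset.disjoint_right.1 hd hi (Multiset.mem_toFinset.2 h')
    simp [this]

lemma card_partition_eq {α : Type*} [Fintype α] [DecidableEq α]
    (p : (Fintype.card α).Partition) :
    ((Finset.univ.filter fun σ : Equiv.Perm α => σ.partition = p).card : ℝ) =
      (Fintype.card α).factorial * cycleWeight p.parts := by
  classical
  set m := p.parts.filter (2 ≤ ·) with hm
  set a := p.parts.count 1 with ha
  have hp : p.parts = m + Multiset.replicate a 1 := by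
    rw [← Multiset.filter_add_not (2 ≤ ·) p.parts, ← hm, ha, ← Multiset.filter_eq']
    congr 1
    refine Multiset.filter_congr fun x hx => ?_
    have := p.parts_pos hx
    omega
  have hsum : m.sum + a = Fintype.card α := by
    have := p.parts_sum
    rw [hp] at this
    simpa using this
  have hm2 : ∀ x ∈ m, 2 ≤ x := fun x hx => (Multiset.mem_filter.1 hx).2
  have hset : (Finset.univ.filter fun σ : Equiv.Perm α => σ.partition = p) =
      Finset.univ.filter fun σ : Equiv.Perm α => σ.cycleType = m := by
    ext σ
    simp only [Finset.mem_filter, Finset.mem_univ, true_and]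
    constructor
    · rintro rfl
      exact Equiv.Perm.filter_parts_partition_eq_cycleType.symm
    · intro h
      rw [Nat.Partition.ext_iff, Equiv.Perm.parts_partition, h, hp, ← Equiv.Perm.sum_cycleType, h]
      congr 2
      omega
  have hcard := Equiv.Perm.card_of_cycleType_mul_eq α m
  rw [if_pos ⟨by omega, hm2⟩, ← hset, show Fintype.card α - m.sum = a by omega] at hcard
  have hd : Disjoint m (Multiset.replicate a 1) := by
    rw [Multiset.disjoint_left]
    intro x hx hx'
    have := hm2 x hx
    have := Multiset.eq_of_mem_replicate hx'
    omega
  have hw1 : cycleWeight (Multiset.replicate a 1) = 1 / (a.factorial : ℝ) := by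
    rw [cycleWeight, Multiset.toFinset_replicate]
    split_ifs with h0
    · simp [h0]
    · simp
  have hprod : (m.prod : ℝ) = ∏ i ∈ m.toFinset, (i : ℝ) ^ m.count i := by
    rw [Finset.prod_multiset_count]
    push_cast
    rfl
  rw [hp, cycleWeight_add_of_disjoint hd, hw1, cycleWeight, Finset.prod_div_distrib, ← hcard]
  simp only [one_div, inv_pow, Finset.prod_inv_distrib]
  rw [Nat.cast_mul, Nat.cast_mul, Nat.cast_mul, hprod, Nat.cast_prod]
  have h1 : ∏ i ∈ m.toFinset, (i : ℝ) ^ m.count i ≠ 0 := Finset.prod_ne_zero_iff.2 fun i hi => by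
    have := hm2 i (Multiset.mem_toFinset.1 hi)
    positivity
  have h2 : ∏ i ∈ m.toFinset, ((m.count i).factorial : ℝ) ≠ 0 := Finset.prod_ne_zero_iff.2
    fun i _ => by positivity
  have h3 : (a.factorial : ℝ) ≠ 0 := by positivity
  have key (N a A B : ℝ) (ha : a ≠ 0) (hA : A ≠ 0) (hB : B ≠ 0) :
      N = N * (a * A * B) * (A⁻¹ / B * a⁻¹) := by field_simp
  exact key _ _ _ _ h3 h1 h2

/-- The multiset containing `j` with multiplicity `c_j`, for `j ∈ {1,…,k}`. -/
def ofCounts {k : ℕ} (c : Fin k → ℕ) : Multiset ℕ :=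
  ∑ j : Fin k, Multiset.replicate (c j) ((j : ℕ) + 1)

/-- The multiplicities of `1,…,k` in a multiset. -/
def smallCounts (k : ℕ) (s : Multiset ℕ) (j : Fin k) : ℕ := s.count ((j : ℕ) + 1)

lemma mem_ofCounts_bounds {k : ℕ} {c : Fin k → ℕ} {i : ℕ} (h : i ∈ ofCounts c) :
    1 ≤ i ∧ i ≤ k := by
  rw [ofCounts, Multiset.mem_sum] at h
  obtain ⟨j, -, hj⟩ := h
  have := Multiset.eq_of_mem_replicate hj
  omega

@[simp] lemma smallCounts_ofCounts {k : ℕ} (c : Fin k → ℕ) : smallCounts k (ofCounts c) = c := by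
  ext j
  simp [smallCounts, ofCounts, Multiset.count_sum', Multiset.count_replicate, Fin.val_inj]

@[simp] lemma sum_ofCounts {k : ℕ} (c : Fin k → ℕ) : (ofCounts c).sum = totalSize c := by
  simp [ofCounts, totalSize, Multiset.sum_sum, mul_comm]

lemma ofCounts_smallCounts {k : ℕ} {s : Multiset ℕ} (hs : ∀ i ∈ s, 1 ≤ i) :
    ofCounts (smallCounts k s) = s.filter (· ≤ k) := by
  ext i
  by_cases hi : 1 ≤ i ∧ i ≤ k
  · obtain ⟨j, rfl⟩ : ∃ j : Fin k, i = j + 1 := ⟨⟨i - 1, by omega⟩, by simp; omega⟩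
    rw [Multiset.count_filter_of_pos (p := (· ≤ k)) hi.2]
    exact congrFun (smallCounts_ofCounts (smallCounts k s)) j
  · rw [Multiset.count_eq_zero.2 fun h => hi (mem_ofCounts_bounds h), eq_comm,
      Multiset.count_eq_zero]
    intro h
    rw [Multiset.mem_filter] at h
    exact hi ⟨hs i h.1, h.2⟩

lemma cycleWeight_ofCounts {k : ℕ} (c : Fin k → ℕ) :
    cycleWeight (ofCounts c) = expWeight (fun j : Fin k => 1 / (((j : ℕ) : ℝ) + 1)) c := by
  have hsub : (ofCounts c).toFinset ⊆ Finset.univ.image fun j : Fin k => (j : ℕ) + 1 := by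
    intro i hi
    have := mem_ofCounts_bounds (Multiset.mem_toFinset.1 hi)
    simp only [Finset.mem_image, Finset.mem_univ, true_and]
    exact ⟨⟨i - 1, by omega⟩, by simp; omega⟩
  rw [cycleWeight, Finset.prod_subset hsub, Finset.prod_image]
  · refine Finset.prod_congr rfl fun j _ => ?_
    have := congrFun (smallCounts_ofCounts c) j
    rw [smallCounts] at this
    rw [this]
    push_cast
    rfl
  · intro a _ b _ h
    exact Fin.ext (by simpa using h)
  · intro i _ hi
    rw [Multiset.mem_toFinset, ← Multiset.count_eq_zero] at hi
    simp [hi]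

/-- The proportion of permutations of `n` points all of whose cycles are longer than `k`. -/
def longCycleWeight (k n : ℕ) : ℝ :=
  ∑ p : n.Partition with ∀ i ∈ p.parts, k < i, cycleWeight p.parts

lemma sum_cycleWeight_smallCounts_eq (k n : ℕ) (c : Fin k → ℕ) :
    ∑ p : n.Partition with smallCounts k p.parts = c, cycleWeight p.parts =
      if totalSize c ≤ n then expWeight (fun j : Fin k => 1 / (((j : ℕ) : ℝ) + 1)) c *
        longCycleWeight k (n - totalSize c) else 0 := by
  split_ifs with hc
  · have hd (p : (n - totalSize c).Partition) (hp : ∀ i ∈ p.parts, k < i) :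
        Disjoint (ofCounts c) p.parts := by
      rw [Multiset.disjoint_left]
      intro i hi hi'
      have := mem_ofCounts_bounds hi
      have := hp i hi'
      omega
    rw [longCycleWeight, Finset.mul_sum, eq_comm]
    refine Finset.sum_bij (fun p _ => ⟨ofCounts c + p.parts, ?_, ?_⟩) ?_ ?_ ?_ ?_
    · intro i hi
      rcases Multiset.mem_add.1 hi with hi | hi
      · exact (mem_ofCounts_bounds hi).1
      · exact p.parts_pos hi
    · rw [Multiset.sum_add, sum_ofCounts, p.parts_sum]
      omega
    · intro p hp
      simp only [Finset.mem_filter, Finset.mem_univ, true_and] at hp ⊢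
      ext j
      have h0 : p.parts.count ((j : ℕ) + 1) = 0 :=
        Multiset.count_eq_zero.2 fun h => by have := hp _ h; omega
      rw [smallCounts, Multiset.count_add, h0, add_zero]
      exact congrFun (smallCounts_ofCounts c) j
    · intro p _ q _ h
      rw [Nat.Partition.ext_iff] at h ⊢
      simpa using h
    · intro p hp
      simp only [Finset.mem_filter, Finset.mem_univ, true_and] at hp
      have hs : ofCounts c + p.parts.filter (¬ · ≤ k) = p.parts := by
        rw [← hp, ofCounts_smallCounts fun i hi => p.parts_pos hi, Multiset.filter_add_not]
      refine ⟨⟨p.parts.filter (¬ · ≤ k), fun hi => p.parts_pos (Multiset.mem_filter.1 hi).1, ?_⟩,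
        ?_, ?_⟩
      · have := congrArg Multiset.sum hs
        rw [Multiset.sum_add, sum_ofCounts, p.parts_sum] at this
        omega
      · simp
      · exact Nat.Partition.ext hs
    · intro p hp
      simp only [Finset.mem_filter, Finset.mem_univ, true_and] at hp
      rw [cycleWeight_add_of_disjoint (hd p hp), cycleWeight_ofCounts]
  · refine Finset.sum_eq_zero fun p hp => absurd ?_ hc
    simp only [Finset.mem_filter, Finset.mem_univ, true_and] at hp
    have h := congrArg Multiset.sum (Multiset.filter_add_not (· ≤ k) p.parts)
    rw [← ofCounts_smallCounts fun i hi => p.parts_pos hi, hp, Multiset.sum_add, sum_ofCounts,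
      p.parts_sum] at h
    omega

lemma card_smallCounts_eq (k n : ℕ) (c : Fin k → ℕ) :
    ((Finset.univ.filter fun σ : Equiv.Perm (Fin n) =>
        smallCounts k σ.partition.parts = c).card : ℝ) / n.factorial =
      if totalSize c ≤ n then expWeight (fun j : Fin k => 1 / (((j : ℕ) : ℝ) + 1)) c *
        longCycleWeight k (n - totalSize c) else 0 := by
  have h := sum_cycleWeight_smallCounts_eq k (Fintype.card (Fin n)) c
  have h2 : ((Finset.univ.filter fun σ : Equiv.Perm (Fin n) =>
        smallCounts k σ.partition.parts = c).card : ℝ) = (Fintype.card (Fin n)).factorial *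
      ∑ p : (Fintype.card (Fin n)).Partition with smallCounts k p.parts = c,
        cycleWeight p.parts := by
    rw [Finset.card_eq_sum_card_fiberwise (f := Equiv.Perm.partition)
      (t := Finset.univ.filter fun p => smallCounts k p.parts = c) (fun σ hσ => by simpa using hσ),
      Nat.cast_sum, Finset.mul_sum]
    refine Finset.sum_congr rfl fun p hp => ?_
    rw [← card_partition_eq, Finset.filter_filter]
    congr 2
    ext σ
    simp only [Finset.mem_filter, Finset.mem_univ, true_and, and_iff_right_iff_imp] at hp ⊢
    rintro rfl
    exact hp
  rw [h2, h, Fintype.card_fin]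
  exact mul_div_cancel_left₀ _ (by positivity)

lemma sum_expWeight_mul_longCycleWeight (k n : ℕ) :
    ∑ c ∈ boundedSize k n, expWeight (fun j : Fin k => 1 / (((j : ℕ) : ℝ) + 1)) c *
      longCycleWeight k (n - totalSize c) = 1 := by
  have h1 : ∑ c ∈ boundedSize k n, ((Finset.univ.filter fun σ : Equiv.Perm (Fin n) =>
        smallCounts k σ.partition.parts = c).card : ℝ) / n.factorial = 1 := by
    rw [← Finset.sum_div, ← Nat.cast_sum, ← Finset.card_eq_sum_card_fiberwise]
    · rw [Finset.card_univ, Fintype.card_perm, Fintype.card_fin]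
      exact div_self (by positivity)
    · intro σ _
      rw [Finset.mem_coe, mem_boundedSize, ← sum_ofCounts,
        ofCounts_smallCounts fun i hi => σ.partition.parts_pos hi]
      have h := congrArg Multiset.sum (Multiset.filter_add_not (· ≤ k) σ.partition.parts)
      rw [Multiset.sum_add, σ.partition.parts_sum] at h
      have := Fintype.card_fin n
      omega
  refine Eq.trans ?_ h1
  refine Finset.sum_congr rfl fun c hc => ?_
  rw [card_smallCounts_eq, if_pos (mem_boundedSize.1 hc)]

lemma tendsto_card_smallCounts (k : ℕ) (c : Fin k → ℕ) :
    Filter.Tendsto (fun n : ℕ => ((Finset.univ.filter fun σ : Equiv.Perm (Fin n) =>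
        smallCounts k σ.partition.parts = c).card : ℝ) / n.factorial) Filter.atTop
      (nhds (pmfVec k c)) := by
  have h := (((tendsto_of_convolution _ _ (sum_expWeight_mul_longCycleWeight k)).comp
    (Filter.tendsto_sub_atTop_nat (totalSize c))).const_mul
      (expWeight (fun j : Fin k => 1 / (((j : ℕ) : ℝ) + 1)) c))
  have hv : expWeight (fun j : Fin k => 1 / (((j : ℕ) : ℝ) + 1)) c *
      Real.exp (-∑ j : Fin k, 1 / (((j : ℕ) : ℝ) + 1)) = pmfVec k c := by
    rw [pmfVec, expWeight, ← Finset.sum_neg_distrib, Real.exp_sum, ← Finset.prod_mul_distrib]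
    refine Finset.prod_congr rfl fun j _ => ?_
    rw [poissonPdf]
    ring
  rw [hv] at h
  refine h.congr' ?_
  filter_upwards [Filter.eventually_ge_atTop (totalSize c)] with n hn
  rw [card_smallCounts_eq, if_pos hn]
  rfl

lemma exists_le_map_iff {α β : Type*} [DecidableEq α] (f : α → β) (s : Finset α) (t : Multiset β) :
    t ≤ s.val.map f ↔ ∃ u ⊆ s, u.val.map f = t := by
  constructor
  · intro h
    induction s using Finset.induction_on generalizing t with
    | empty =>
      rw [Finset.empty_val, Multiset.map_zero, Multiset.le_zero] at h
      exact ⟨∅, subset_rfl, h.symm⟩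
    | insert a s ha ih =>
      rw [Finset.insert_val_of_notMem ha, Multiset.map_cons] at h
      by_cases hat : f a ∈ t
      · obtain ⟨t, rfl⟩ := Multiset.exists_cons_of_mem hat
        obtain ⟨u, hu, rfl⟩ := ih t ((Multiset.cons_le_cons_iff _).1 h)
        refine ⟨insert a u, Finset.insert_subset_insert a hu, ?_⟩
        rw [Finset.insert_val_of_notMem fun hau => ha (hu hau), Multiset.map_cons]
      · obtain ⟨u, hu, rfl⟩ := ih t ((Multiset.le_cons_of_notMem hat).1 h)
        exact ⟨u, hu.trans (Finset.subset_insert a s), rfl⟩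
  · rintro ⟨u, hu, rfl⟩
    exact Multiset.map_le_map (Finset.val_le_iff.2 hu)

lemma exists_invariant_iff {α : Type*} [Fintype α] [DecidableEq α] (σ : Equiv.Perm α) (k : ℕ) :
    (∃ s : Finset α, s.card = k ∧ ∀ x ∈ s, σ x ∈ s) ↔
      ∃ t ≤ σ.partition.parts, t.sum = k := by
  have hfix : (σ.supportᶜ).card = Fintype.card α - σ.support.card := Finset.card_compl _
  have hdisj (T : Finset (Equiv.Perm α)) (hT : T ⊆ σ.cycleFactorsFinset) :
      (T.biUnion Equiv.Perm.support).card =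
        (T.val.map (Finset.card ∘ Equiv.Perm.support)).sum := by
    refine Finset.card_biUnion fun a ha b hb hab => ?_
    exact (σ.cycleFactorsFinset_pairwise_disjoint (hT ha) (hT hb) hab).disjoint_support
  have hsub (T : Finset (Equiv.Perm α)) (hT : T ⊆ σ.cycleFactorsFinset) :
      T.biUnion Equiv.Perm.support ⊆ σ.support :=
    Finset.biUnion_subset.2 fun τ hτ => Equiv.Perm.mem_cycleFactorsFinset_support_le (hT hτ)
  have hcard (T : Finset (Equiv.Perm α)) (hT : T ⊆ σ.cycleFactorsFinset) (B : Finset α)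
      (hB : B ⊆ σ.supportᶜ) : (T.biUnion Equiv.Perm.support ∪ B).card =
        (T.val.map (Finset.card ∘ Equiv.Perm.support) + Multiset.replicate B.card 1).sum := by
    rw [Finset.card_union_of_disjoint, hdisj T hT]
    · simp
    · exact Finset.disjoint_of_subset_left (hsub T hT)
        (Finset.disjoint_of_subset_right hB disjoint_compl_right)
  rw [Equiv.Perm.parts_partition, Equiv.Perm.cycleType_def, ← hfix]
  constructor
  · rintro ⟨s, rfl, hs⟩
    set T := σ.cycleFactorsFinset.filter fun τ => τ.support ⊆ s with hTdef
    have hT : T ⊆ σ.cycleFactorsFinset := Finset.filter_subset _ _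
    have hB : s ∩ σ.supportᶜ ⊆ σ.supportᶜ := Finset.inter_subset_right
    refine ⟨T.val.map (Finset.card ∘ Equiv.Perm.support) +
      Multiset.replicate (s ∩ σ.supportᶜ).card 1, add_le_add (Multiset.map_le_map
        (Finset.val_le_iff.2 hT)) (Multiset.replicate_mono _ (Finset.card_le_card hB)), ?_⟩
    rw [← hcard T hT _ hB]
    congr 1
    ext x
    simp only [Finset.mem_union, Finset.mem_biUnion, Finset.mem_inter, Finset.mem_compl]
    constructor
    · rintro (⟨τ, hτ, hx⟩ | h)
      · exact (Finset.mem_filter.1 hτ).2 hx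
      · exact h.1
    · intro hx
      by_cases hxs : x ∈ σ.support
      · refine Or.inl ⟨σ.cycleOf x, Finset.mem_filter.2
          ⟨Equiv.Perm.cycleOf_mem_cycleFactorsFinset_iff.2 hxs, fun y hy => ?_⟩, ?_⟩
        · obtain ⟨n, rfl⟩ :=
            (Equiv.Perm.mem_support_cycleOf_iff.1 hy).1.exists_nat_pow_eq
          clear hy
          induction n with
          | zero => simpa using hx
          | succ n ih => rw [pow_succ', Equiv.Perm.mul_apply]; exact hs _ ih
        · exact Equiv.Perm.mem_support_cycleOf_iff.2 ⟨Equiv.Perm.SameCycle.refl _ _, hxs⟩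
      · exact Or.inr ⟨hx, hxs⟩
  · rintro ⟨t, ht, rfl⟩
    obtain ⟨t₁, h₁, t₂, h₂, rfl⟩ : ∃ t₁ ≤ σ.cycleFactorsFinset.val.map
        (Finset.card ∘ Equiv.Perm.support), ∃ t₂ ≤ Multiset.replicate (σ.supportᶜ).card 1,
        t = t₁ + t₂ :=
      ⟨t - Multiset.replicate (σ.supportᶜ).card 1, tsub_le_iff_right.2 ht,
        t ∩ Multiset.replicate (σ.supportᶜ).card 1, Multiset.inter_le_right,
        (Multiset.sub_add_inter _ _).symm⟩
    obtain ⟨T, hT, rfl⟩ := (exists_le_map_iff _ _ _).1 h₁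
    obtain ⟨b, hb, rfl⟩ := Multiset.le_replicate_iff.1 h₂
    obtain ⟨B, hB, rfl⟩ := Finset.exists_subset_card_eq hb
    refine ⟨_, hcard T hT B hB, fun x hx => ?_⟩
    rw [Finset.mem_union, Finset.mem_biUnion] at hx ⊢
    rcases hx with ⟨τ, hτ, hx⟩ | hx
    · refine Or.inl ⟨τ, hτ, ?_⟩
      rw [← ((Equiv.Perm.mem_cycleFactorsFinset_iff.1 (hT hτ)).2 x hx)]
      exact Equiv.Perm.apply_mem_support.2 hx
    · have : σ x = x := by simpa using hB hx
      exact Or.inr (by rwa [this])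

lemma ofCounts_mono {k : ℕ} {c d : Fin k → ℕ} (h : c ≤ d) : ofCounts c ≤ ofCounts d :=
  Finset.sum_le_sum fun j _ => Multiset.replicate_mono _ (h j)

lemma mem_Lset_smallCounts_iff {k : ℕ} {s : Multiset ℕ} (hs : ∀ i ∈ s, 1 ≤ i) :
    k ∈ Lset k (smallCounts k s) ↔ ∃ t ≤ s, t.sum = k := by
  simp only [Lset, Finset.mem_image, Finset.mem_Icc]
  constructor
  · rintro ⟨m, ⟨-, hm⟩, hk⟩
    refine ⟨ofCounts m, (ofCounts_mono hm).trans ?_, (sum_ofCounts m).trans hk⟩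
    rw [ofCounts_smallCounts hs]
    exact Multiset.filter_le _ _
  · rintro ⟨t, ht, hk⟩
    refine ⟨smallCounts k t, ⟨fun _ => Nat.zero_le _, fun j => Multiset.count_le_of_le _ ht⟩, ?_⟩
    rw [← totalSize, ← sum_ofCounts,
      ofCounts_smallCounts fun i hi => hs i (Multiset.mem_of_le ht hi),
      Multiset.filter_eq_self.2, hk]
    intro i hi
    exact (Multiset.le_sum_of_mem hi).trans hk.le

lemma hasInvariantSet_iff {n k : ℕ} (σ : Equiv.Perm (Fin n)) :
    hasInvariantSet n k σ ↔ k ∈ Lset k (smallCounts k σ.partition.parts) := by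
  rw [hasInvariantSet, exists_invariant_iff,
    mem_Lset_smallCounts_iff fun i hi => σ.partition.parts_pos hi]

lemma iProp_eq_tsum (n k : ℕ) : iProp n k = ∑' c : Fin k → ℕ, if k ∈ Lset k c then
    ((Finset.univ.filter fun σ : Equiv.Perm (Fin n) =>
        smallCounts k σ.partition.parts = c).card : ℝ) / n.factorial else 0 := by
  classical
  rw [tsum_eq_sum (s := Finset.univ.image fun σ : Equiv.Perm (Fin n) =>
    smallCounts k σ.partition.parts), iProp, Nat.card_eq_fintype_card, Nat.card_eq_fintype_card,
    Fintype.card_perm, congrArg Nat.factorial (Fintype.card_fin n), Fintype.card_subtype,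
    ← Finset.sum_filter,
    ← Finset.sum_div, ← Nat.cast_sum]
  · congr 2
    rw [Finset.card_eq_sum_card_fiberwise (f := fun σ : Equiv.Perm (Fin n) =>
      smallCounts k σ.partition.parts) (t := (Finset.univ.image fun σ : Equiv.Perm (Fin n) =>
        smallCounts k σ.partition.parts).filter fun c => k ∈ Lset k c)]
    · refine Finset.sum_congr rfl fun c hc => ?_
      rw [Finset.filter_filter]
      congr 1
      ext σ
      simp only [Finset.mem_filter, Finset.mem_univ, true_and, and_iff_right_iff_imp] at hc ⊢
      rintro rfl
      exact (hasInvariantSet_iff σ).2 hc.2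
    · intro σ hσ
      simpa [hasInvariantSet_iff] using hσ
  · intro c hc
    rw [Finset.filter_eq_empty_iff.2]
    · simp
    · intro σ _ h
      exact hc (Finset.mem_image.2 ⟨σ, Finset.mem_univ _, h⟩)

theorem i_infty_eq_prob (k : ℕ) (hk : 1 ≤ k) :
    Filter.Tendsto (fun n => iProp n k) Filter.atTop
      (nhds (∑' c : Fin k → ℕ, if k ∈ Lset k c then pmfVec k c else 0)) := by
  obtain ⟨M, hM⟩ := (tendsto_of_convolution _ _
    (sum_expWeight_mul_longCycleWeight k)).norm.bddAbove_range
  have hM' (n : ℕ) : ‖longCycleWeight k n‖ ≤ M := hM ⟨n, rfl⟩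
  have hM0 : 0 ≤ M := (norm_nonneg _).trans (hM' 0)
  rw [funext fun n => iProp_eq_tsum n k]
  refine tendsto_tsum_of_dominated_convergence
    ((expWeight_hasSum fun j : Fin k => 1 / (((j : ℕ) : ℝ) + 1)).1.mul_right M) (fun c => ?_)
    (Filter.Eventually.of_forall fun n c => ?_)
  · split_ifs
    · exact tendsto_card_smallCounts k c
    · exact tendsto_const_nhds
  · rw [card_smallCounts_eq]
    split_ifs
    · rw [norm_mul]
      exact mul_le_mul_of_nonneg_left (hM' _) (norm_nonneg _)
    all_goals simpa using by positivity
end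
end
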